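/- For n = 8, the polynomial x_1x_2⋯x_8 + 11/1000 belongs to the degree-8 truncated quadratic module M_{8,8}(g) of the hypercube: there exist sums of squares σ_0, σ_1, …, σ_8 ∈ ℝ[x_1,…,x_8] with deg σ_0 ≤ 8 and deg σ_i ≤ 6 for i = 1,…,8 such that x_1x_2⋯x_8 + 11/1000 = σ_0 + Σ_{i=1}^8 σ_i·(x_i - x_i²). In particular, the smallest constant C_8 with x_1⋯x_8 + C_8 ∈ M_{8,8}(g) satisfies C_8 ≤ 11/1000 < 1/80. -/

import Mathlib

open MvPolynomial

/-- A polynomial is a sum of squares. -/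
def IsSOS {n : ℕ} (p : MvPolynomial (Fin n) ℝ) : Prop :=
  ∃ (k : ℕ) (q : Fin k → MvPolynomial (Fin n) ℝ), p = ∑ j, (q j) ^ 2

/-- Membership in the degree-`2d` truncated quadratic module `M_{n,2d}(g)` of the
hypercube, where `g_i = x_i - x_i^2`. -/
def InQuadModule (n d : ℕ) (p : MvPolynomial (Fin n) ℝ) : Prop :=
  ∃ (σ₀ : MvPolynomial (Fin n) ℝ) (σ : Fin n → MvPolynomial (Fin n) ℝ),
    IsSOS σ₀ ∧ (∀ i, IsSOS (σ i)) ∧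
    σ₀.totalDegree ≤ 2 * d ∧ (∀ i, (σ i).totalDegree ≤ 2 * d - 2) ∧
    p = σ₀ + ∑ i, σ i * (X i - (X i) ^ 2)

set_option linter.unusedVariables false
set_option linter.unusedSimpArgs false

namespace HypercubeCert

/-! The certificate is invariant under permutations of the variables; it is written through the
power sums `p_k = ∑ x_i ^ k`, and consists of four families of squares. -/

/-- Sum of squares of polynomials of degree at most `D`. -/
def SOSd (D : ℕ) (p : MvPolynomial (Fin 8) ℝ) : Prop :=
  IsSOS p ∧ p.totalDegree ≤ 2 * D

lemma SOSd.zero (D : ℕ) : SOSd D 0 := by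
  refine ⟨⟨0, Fin.elim0, by simp⟩, by simp⟩

lemma SOSd.add {D : ℕ} {p q : MvPolynomial (Fin 8) ℝ} (hp : SOSd D p) (hq : SOSd D q) :
    SOSd D (p + q) := by
  obtain ⟨⟨k, f, hf⟩, hd⟩ := hp
  obtain ⟨⟨l, g, hg⟩, he⟩ := hq
  refine ⟨⟨k + l, Fin.append f g, ?_⟩, ?_⟩
  · rw [Fin.sum_univ_add, hf, hg]
    simp
  · exact (totalDegree_add _ _).trans (max_le hd he)

lemma SOSd.sum {D : ℕ} {ι : Type*} (s : Finset ι) (f : ι → MvPolynomial (Fin 8) ℝ)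
    (h : ∀ i, SOSd D (f i)) : SOSd D (∑ i ∈ s, f i) := by
  classical
  induction s using Finset.induction_on with
  | empty => simpa using SOSd.zero D
  | insert a s ha ih => rw [Finset.sum_insert ha]; exact (h a).add ih

lemma SOSd.sq {D : ℕ} {q : MvPolynomial (Fin 8) ℝ} (hq : q.totalDegree ≤ D) {c : ℝ}
    (hc : 0 ≤ c) : SOSd D (C c * q ^ 2) := by
  refine ⟨⟨1, fun _ => C (Real.sqrt c) * q, ?_⟩, ?_⟩
  · simp only [Finset.univ_unique, Finset.sum_const, Finset.card_singleton, one_smul]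
    rw [mul_pow, ← C_pow, Real.sq_sqrt hc]
  · refine (totalDegree_mul _ _).trans ?_
    rw [totalDegree_C, zero_add]
    exact (totalDegree_pow _ _).trans (Nat.mul_le_mul_left 2 hq)

/-- Linear combination of a list of polynomials. -/
noncomputable def dotP : List ℝ → List (MvPolynomial (Fin 8) ℝ) → MvPolynomial (Fin 8) ℝ
  | c :: cs, v :: vs => C c * v + dotP cs vs
  | [], _ => 0
  | _ :: _, [] => 0

/-- Linear combination of a list of reals. -/
def dotR : List ℝ → List ℝ → ℝ
  | c :: cs, v :: vs => c * v + dotR cs vs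
  | [], _ => 0
  | _ :: _, [] => 0

/-- Weighted sum of squares of linear combinations of polynomials. -/
noncomputable def ldlP (cs : List (ℝ × List ℝ)) (v : List (MvPolynomial (Fin 8) ℝ)) :
    MvPolynomial (Fin 8) ℝ :=
  (cs.map fun c => C c.1 * (dotP c.2 v) ^ 2).sum

/-- Weighted sum of squares of linear combinations of reals. -/
def ldlR (cs : List (ℝ × List ℝ)) (v : List ℝ) : ℝ :=
  (cs.map fun c => c.1 * (dotR c.2 v) ^ 2).sum

lemma eval_dotP (x : Fin 8 → ℝ) (c : List ℝ) (v : List (MvPolynomial (Fin 8) ℝ)) :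
    eval x (dotP c v) = dotR c (v.map (eval x)) := by
  induction c generalizing v with
  | nil => simp [dotP, dotR]
  | cons c cs ih =>
    cases v with
    | nil => simp [dotP, dotR]
    | cons v vs => simp [dotP, dotR, ih]

lemma eval_ldlP (x : Fin 8 → ℝ) (c : List (ℝ × List ℝ)) (v : List (MvPolynomial (Fin 8) ℝ)) :
    eval x (ldlP c v) = ldlR c (v.map (eval x)) := by
  induction c with
  | nil => simp [ldlP, ldlR]
  | cons c cs ih =>
    simp only [ldlP, ldlR, List.map_cons, List.sum_cons, map_add, map_mul, map_pow, eval_C,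
      eval_dotP] at ih ⊢
    rw [ih]

lemma dotP_deg {D : ℕ} (c : List ℝ) (v : List (MvPolynomial (Fin 8) ℝ))
    (hv : ∀ q ∈ v, q.totalDegree ≤ D) : (dotP c v).totalDegree ≤ D := by
  induction c generalizing v with
  | nil => simp [dotP]
  | cons c cs ih =>
    cases v with
    | nil => simp [dotP]
    | cons v vs =>
      refine (totalDegree_add _ _).trans (max_le ?_ ?_)
      · refine (totalDegree_mul _ _).trans ?_
        rw [totalDegree_C, zero_add]
        exact hv v (by simp)
      · exact ih vs (fun q hq => hv q (by simp [hq]))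

lemma ldlP_sos {D : ℕ} (c : List (ℝ × List ℝ)) (v : List (MvPolynomial (Fin 8) ℝ))
    (hc : ∀ r ∈ c, (0:ℝ) ≤ r.1) (hv : ∀ q ∈ v, q.totalDegree ≤ D) : SOSd D (ldlP c v) := by
  induction c with
  | nil => simpa [ldlP] using SOSd.zero D
  | cons c cs ih =>
    have := ih (fun r hr => hc r (by simp [hr]))
    simp only [ldlP, List.map_cons, List.sum_cons] at this ⊢
    exact (SOSd.sq (dotP_deg _ _ hv) (hc c (by simp))).add this

/-- Power sums of real numbers. -/
def ps (x : Fin 8 → ℝ) (k : ℕ) : ℝ := ∑ i, x i ^ k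

lemma ps_zero (x : Fin 8 → ℝ) : ps x 0 = 8 := by simp [ps]

/-- Polynomial in one variable given by a list of monomials. -/
def ev1 (l : List (ℝ × ℕ)) (a : ℝ) : ℝ := (l.map fun t => t.1 * a ^ t.2).sum

/-- Polynomial in two variables given by a list of monomials. -/
def ev2 (l : List (ℝ × ℕ × ℕ)) (a b : ℝ) : ℝ :=
  (l.map fun t => t.1 * (a ^ t.2.1 * b ^ t.2.2)).sum

/-- Polynomial in three variables given by a list of monomials. -/
def ev3 (l : List (ℝ × ℕ × ℕ × ℕ)) (a b c : ℝ) : ℝ :=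
  (l.map fun t => t.1 * (a ^ t.2.1 * (b ^ t.2.2.1 * c ^ t.2.2.2))).sum

lemma sum_ev1 (x : Fin 8 → ℝ) (l : List (ℝ × ℕ)) :
    ∑ i, ev1 l (x i) = (l.map fun t => t.1 * ps x t.2).sum := by
  induction l with
  | nil => simp [ev1]
  | cons t l ih =>
    simp only [ev1, List.map_cons, List.sum_cons, Finset.sum_add_distrib] at ih ⊢
    rw [ih]
    simp only [ps, ← Finset.mul_sum]

lemma sum_ev2 (x : Fin 8 → ℝ) (l : List (ℝ × ℕ × ℕ)) :
    ∑ i, ∑ j, ev2 l (x i) (x j) = (l.map fun t => t.1 * (ps x t.2.1 * ps x t.2.2)).sum := by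
  induction l with
  | nil => simp [ev2]
  | cons t l ih =>
    simp only [ev2, List.map_cons, List.sum_cons, Finset.sum_add_distrib] at ih ⊢
    rw [ih]
    simp only [ps, ← Finset.mul_sum, ← Finset.sum_mul]

lemma sum_ev3 (x : Fin 8 → ℝ) (l : List (ℝ × ℕ × ℕ × ℕ)) :
    ∑ i, ∑ j, ∑ k, ev3 l (x i) (x j) (x k) =
      (l.map fun t => t.1 * (ps x t.2.1 * (ps x t.2.2.1 * ps x t.2.2.2))).sum := by
  induction l with
  | nil => simp [ev3]
  | cons t l ih =>
    simp only [ev3, List.map_cons, List.sum_cons, Finset.sum_add_distrib] at ih ⊢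
    rw [ih]
    simp only [ps, ← Finset.mul_sum, ← Finset.sum_mul]

/-- Sum over ordered pairs of distinct indices. -/
def S2 (x : Fin 8 → ℝ) (F : ℝ → ℝ → ℝ) : ℝ :=
  ∑ i, ∑ j, if i = j then 0 else F (x i) (x j)

/-- Sum over ordered triples of distinct indices. -/
def S3 (x : Fin 8 → ℝ) (F : ℝ → ℝ → ℝ → ℝ) : ℝ :=
  ∑ i, ∑ j, ∑ k, if i = j ∨ i = k ∨ j = k then 0 else F (x i) (x j) (x k)

lemma S2_eq (x : Fin 8 → ℝ) (F : ℝ → ℝ → ℝ) :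
    S2 x F = (∑ i, ∑ j, F (x i) (x j)) - ∑ i, F (x i) (x i) := by
  have h : ∀ i j : Fin 8, (if i = j then 0 else F (x i) (x j)) =
      F (x i) (x j) - if i = j then F (x i) (x j) else 0 := by
    intro i j; split_ifs <;> simp
  simp only [S2, h, Finset.sum_sub_distrib, Finset.sum_ite_eq, Finset.mem_univ, if_true]

lemma S3_eq (x : Fin 8 → ℝ) (F : ℝ → ℝ → ℝ → ℝ) (h1 : ∀ a b, F a b a = F a a b)
    (h2 : ∀ a b, F b a a = F a a b) :
    S3 x F = (∑ i, ∑ j, ∑ k, F (x i) (x j) (x k)) - 3 * (∑ i, ∑ j, F (x i) (x i) (x j))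
      + 2 * ∑ i, F (x i) (x i) (x i) := by
  have h : ∀ i j k : Fin 8, (if i = j ∨ i = k ∨ j = k then 0 else F (x i) (x j) (x k)) =
      F (x i) (x j) (x k) - (if i = j then F (x i) (x j) (x k) else 0)
      - (if i = k then F (x i) (x j) (x k) else 0) - (if j = k then F (x i) (x j) (x k) else 0)
      + 2 * (if i = j then (if i = k then F (x i) (x j) (x k) else 0) else 0) := by
    intro i j k
    by_cases a : i = j
    · by_cases b : i = k
      · subst a; subst b; simp; ring
      · subst a; simp [b]
    · by_cases b : i = k
      · subst b; simp [a, Ne.symm a]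
      · by_cases c : j = k
        · subst c; simp [a]
        · simp [a, b, c]
  have e1 : (∑ i, ∑ j, ∑ k, if i = j then F (x i) (x j) (x k) else 0)
      = ∑ i, ∑ j, F (x i) (x i) (x j) := by
    refine Finset.sum_congr rfl fun i _ => ?_
    rw [Finset.sum_comm]
    simp
  have e2 : (∑ i, ∑ j, ∑ k, if i = k then F (x i) (x j) (x k) else 0)
      = ∑ i, ∑ j, F (x i) (x i) (x j) := by
    simp [h1]
  have e3 : (∑ i, ∑ j, ∑ k, if j = k then F (x i) (x j) (x k) else 0)
      = ∑ i, ∑ j, F (x i) (x i) (x j) := by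
    rw [Finset.sum_comm]
    simp [h2]
  have e4 : (∑ i, ∑ j, ∑ k : Fin 8,
      if i = j then (if i = k then F (x i) (x j) (x k) else 0) else 0)
      = ∑ i, F (x i) (x i) (x i) := by
    refine Finset.sum_congr rfl fun i _ => ?_
    rw [Finset.sum_comm]
    simp
  simp only [S3, h, Finset.sum_sub_distrib, Finset.sum_add_distrib, ← Finset.mul_sum]
  rw [e1, e2, e3, e4]
  ring


/-- Projected covariant `w11`, scaled to have integer coefficients. -/
def w11 {A : Type*} [CommRing A] (p1 p2 a b : A) : A :=
    42*a*b - 7*a*p1 + 7*a^2 - 7*b*p1 + 7*b^2 + p1*p1 - p2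

/-- Projected covariant `w21`, scaled to have integer coefficients. -/
def w21 {A : Type*} [CommRing A] (p1 p2 p3 a b : A) : A :=
    42*a^2*b + 42*a*b^2 - 7*a^2*p1 - 7*a*p2 + 14*a^3 - 7*b^2*p1 - 7*b*p2 + 14*b^3 + 2*p1*p2 - 2*p3

/-- Projected covariant `w22`, scaled to have integer coefficients. -/
def w22 {A : Type*} [CommRing A] (p2 p4 a b : A) : A :=
    42*a^2*b^2 - 7*a^2*p2 + 7*a^4 - 7*b^2*p2 + 7*b^4 + p2*p2 - p4

/-- Projected covariant `w31`, scaled to have integer coefficients. -/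
def w31 {A : Type*} [CommRing A] (p1 p3 p4 a b : A) : A :=
    42*a^3*b + 42*a*b^3 - 7*a^3*p1 - 7*a*p3 + 14*a^4 - 7*b^3*p1 - 7*b*p3 + 14*b^4 + 2*p1*p3 - 2*p4

/-- Projected covariant `w111`, scaled to have integer coefficients. -/
def w111 {A : Type*} [CommRing A] (p1 p2 p3 a b c : A) : A :=
    120*a*b*c - 30*a*b*p1 + 30*a^2*b + 30*a*b^2 - 30*a*c*p1 + 30*a^2*c + 30*a*c^2 - 30*b*c*p1
    + 30*b^2*c + 30*b*c^2 + 6*a*p1*p1 - 12*a^2*p1 - 6*a*p2 + 12*a^3 + 6*b*p1*p1 - 12*b^2*p1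
    - 6*b*p2 + 12*b^3 + 6*c*p1*p1 - 12*c^2*p1 - 6*c*p2 + 12*c^3 - p1*p1*p1 + 3*p1*p2 - 2*p3

/-- Projected covariant `w211`, scaled to have integer coefficients. -/
def w211 {A : Type*} [CommRing A] (p1 p2 p3 p4 a b c : A) : A :=
    120*a^2*b*c + 120*a*b^2*c + 120*a*b*c^2 - 30*a^2*b*p1 - 30*a*b^2*p1 - 30*a*b*p2 + 60*a^3*b
    + 60*a^2*b^2 + 60*a*b^3 - 30*a^2*c*p1 - 30*a*c^2*p1 - 30*a*c*p2 + 60*a^3*c + 60*a^2*c^2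
    + 60*a*c^3 - 30*b^2*c*p1 - 30*b*c^2*p1 - 30*b*c*p2 + 60*b^3*c + 60*b^2*c^2 + 60*b*c^3
    + 6*a^2*p1*p1 + 12*a*p1*p2 - 24*a^3*p1 - 18*a^2*p2 - 12*a*p3 + 36*a^4 + 6*b^2*p1*p1
    + 12*b*p1*p2 - 24*b^3*p1 - 18*b^2*p2 - 12*b*p3 + 36*b^4 + 6*c^2*p1*p1 + 12*c*p1*p2 - 24*c^3*p1
    - 18*c^2*p2 - 12*c*p3 + 36*c^4 - 3*p1*p1*p2 + 6*p1*p3 + 3*p2*p2 - 6*p4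

/-- Weights and coefficient rows of the squares of block `cs8`. -/
noncomputable def cs8 : List (ℝ × List ℝ) :=
  [(11/1000, [150909875/2952790016, -900946125/1476395008, 890554625/1476395008, 139344125/92274688
      , -302446625/184549376, -7113625/67108864, 13883375/16777216, -912712407925/425201762304
      , 36499875/184549376, 33546875/92274688, -1460627625/1476395008, 1]),
   (38207146499286107/1585267068834414592, [223015640193223/76414292998572214, -5076405119635897/38207146499286107
      , 1880417147654557/38207146499286107, 11686973448188560/38207146499286107
      , -2248510460880088/5458163785612301, 3532741451791794/38207146499286107
      , 17711871247354504/38207146499286107, -30186531196747187015/77025607342560791712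
      , -24729437118093384/38207146499286107, -15672166900656400/38207146499286107, 1]),
   (209931572402263944537997/2564038198248667451752448, [-29649303857060647057/115824315808145624572688, -9009356468373432436508/209931572402263944537997
      , 3770081415532384321097/57912157904072812286344
      , 59101253200990190818793/209931572402263944537997
      , -71390877630875858303843/419863144804527889075994
      , 156064739308987737426661/3358905158436223112607952
      , -92904188636220697087773/419863144804527889075994
      , -54850457304483562662656983367/67715527994074257950176312320
      , -472229103438472705996261/3358905158436223112607952, 1]),
   (3188076950228588110132312844549/3606596951462319192602619777384448, [-14701431798720346657208663831/3188076950228588110132312844549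
      , 1068205419349916091987106056688/3188076950228588110132312844549
      , -334239375030972343116971058074/3188076950228588110132312844549
      , -25616667031501615587592139960828/22316538651600116770926189911843
      , 13282232066169502261972273815960/3188076950228588110132312844549
      , -871275439185829739752946228757/3188076950228588110132312844549
      , 16993046210479614786089200712/3188076950228588110132312844549
      , -249981900985887932854412831674423961/64271631316608336300267426946107840, 1]),
   (39209981832422376284144284377056768269014650539/695632277504813609647557951664757864768785612800, [-44078728087825600905493540806020989971170520/39209981832422376284144284377056768269014650539
      , 23598307634547288093566407621217631307031040/39209981832422376284144284377056768269014650539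
      , -1044523747260828387050415625691157916824062400/39209981832422376284144284377056768269014650539
      , 9227783260265364557974384453922308690672634760/39209981832422376284144284377056768269014650539
      , -36523736552876923104104977274500518317147586720/39209981832422376284144284377056768269014650539
      , 573489304887701197687671000823177732062278880/39209981832422376284144284377056768269014650539
      , -10603831563552591608615669990103858059038367040/39209981832422376284144284377056768269014650539
      , 1]),
   (8418512407508009120539922041527036850802423726648683/2631337338234504040609464136637227382044819597029277696, [3590558995910636659438648298920253708466161882325357/1077569588161025167429110021315460716902710237011031424
      , 6764145584852944903047791596381770903885626225454197/67348099260064072964319376332216294806419389813189464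
      , -84061020146958295340790902251232740054965474115237/103294630766969437061839534251865482831931579468082
      , 487207580083738085210358791069855313714830949315210301/64654175289661510045746601278927643014162614220661885440
      , -219858831600576183313041447817932169365805848255275/826357046135755496494716274014923862655452635744656
      , -19635027475775027782755953868122576851439066101029197/134696198520128145928638752664432589612838779626378928
      , 1]),
   (423285313514116121258543532062113037332402347333868302775/144628941884868496123154748122992708695932965053962148665884672, [-931175519354786759739751353031781354418484857078488953821/3386282508112928970068348256496904298659218778670946422200
      , 1170812288075126520519334559614414271062738474420447878358/423285313514116121258543532062113037332402347333868302775
      , -1125765192734519098179944074535746897721965843378208168788/423285313514116121258543532062113037332402347333868302775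
      , -18518567321842708994011037072379841689175987652177177874071539/1422238653407430167428706267728699805436871887041797497324000
      , 7909371287117145875181207055417547932338928247681985473793/423285313514116121258543532062113037332402347333868302775
      , 1]),
   (25854855792917102267165312064510383437913170230707094688078543230613/3665081102095194919506058698890991518971756648431795861636736509542400, [-367851901921985362152977284661773346385941626903904063981376254442/25854855792917102267165312064510383437913170230707094688078543230613
      , 5052659413560714131261570850667936919061418150417631744751848428128/25854855792917102267165312064510383437913170230707094688078543230613
      , -6658772642146255655944212673020013241155371552764372740486592306208/25854855792917102267165312064510383437913170230707094688078543230613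
      , -145250616481100118380295434796796562253623531159170945193302101246159/258548557929171022671653120645103834379131702307070946880785432306130
      , 1]),
   (1412019253341537254388699859318703312335424064612562955167811199834128697424790677/2507324425848751118354639321330354972218950997462956864944560380742093530895849881600, [1629220700781909850547483933787948257256230305037911514092335072340157613504220/1412019253341537254388699859318703312335424064612562955167811199834128697424790677
      , -15322765582281392269344872137547389617199957751294230342451441798173076815284800/1412019253341537254388699859318703312335424064612562955167811199834128697424790677
      , -1382927980441895971233949547088166840477039735543296603499222035870203183524457280/1412019253341537254388699859318703312335424064612562955167811199834128697424790677
      , 1]),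
   (322252633614336206277777550205260020592227233839739817482949041809861614839722545213551/3032288257212120612982549183866815783803759869901174401593431647595051690047277688680349696, [242635948633339078869950619562862243344089965665566218437200886918497725933583233944691/7734063206744068950666661204926240494213453612153755619590777003436678756153341085125224
      , -347777723545403231096949277552694788234509134235860649478999273454545640220755195282234/966757900843008618833332650615780061776681701519219452448847125429584844519167635640653
      , 1]),
   (58022631138761922839233361684973230340987364078384796523243612220534150154544948826755842803/332175485381626627850823472726701570148776605074134485097186041329894148645365587217459891446743040, [-8702681280236744459203112613180308591300355977264424733021347308000899115092200722139449280/58022631138761922839233361684973230340987364078384796523243612220534150154544948826755842803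
      , 1]),
   (185686976860301222419750026935436502456623595534311374194283223464501802234230633318149610917/11961854552104977433179972199156774989600751539163578315405399279748805499116347246699675901558494593024, [1])]

lemma cs8_nonneg : ∀ c ∈ cs8, (0:ℝ) ≤ c.1 := by
  simp only [cs8, List.forall_mem_cons]
  refine ⟨by norm_num, by norm_num, by norm_num, by norm_num, by norm_num, by norm_num, by norm_num, by norm_num, by norm_num, by norm_num, by norm_num, by norm_num, ?_⟩
  · intro c hc; simp at hc

/-- Weights and coefficient rows of the squares of block `cs62`. -/
noncomputable def cs62 : List (ℝ × List ℝ) :=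
  [(500625/15032385536, [-653194/31539375, -49634059/168210000, 4478722/31539375, -805453/3003750, 132089/21026250
      , -17962/4505625, -509177/1501875, 1]),
   (23657586479777/7585792713031680000, [45468862863592/70972759439331, 19555514214989/47315172959554, -1336461086296/70972759439331
      , -38702373102136/23657586479777, -1776605265226/23657586479777, -17775262294688/70972759439331
      , 1]),
   (1819997683577772009715/806568751129029936200810496, [-1617642150371114273438/1819997683577772009715, 27510187717462984281733/14559981468622176077720
      , 215892556569811603907/1819997683577772009715, -501548790755831114184/363999536715554401943
      , -964147693627170853461/7279990734311088038860, 1]),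
   (48727608840901650730079838671/772177787052037764369019463018741760, [248081660852131578899269120592/48727608840901650730079838671
      , 3547814408957460807154038617977/292365653045409904380479032026
      , -229927902810906644631324674608/48727608840901650730079838671
      , -37883630916659704890758621360/48727608840901650730079838671, 1]),
   (58095957361481810721172865192837737/26369719284378085186801536250673539055616, [-401353694124169028358305186976319248/406671701530372675048210056349864159
      , -79007047713551169077274567153894917/13943029766755634573081487646281056880
      , -917842985405763960778109881609842/406671701530372675048210056349864159, 1]),
   (5065823341687317652193444772209056138369/1540537942604392182801253920348387620707733864448, [-24727160037039548002147406720567504645886/5065823341687317652193444772209056138369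
      , 32219830937960861054162592556385316996301/101316466833746353043868895444181122767380, 1]),
   (35187078603949823131481035272164616757103818407769/7519407752399775934740830655743254736789996237645414400, [-869840386966497940197012327312775826801442666001560/1724166851593541333442570728336066221098087101980681
      , 1]),
   (126817401615202460364968926016898692768807615873620852981/26125687568277772566195135329722435746846447089795206383956656128, [1])]

lemma cs62_nonneg : ∀ c ∈ cs62, (0:ℝ) ≤ c.1 := by
  simp only [cs62, List.forall_mem_cons]
  refine ⟨by norm_num, by norm_num, by norm_num, by norm_num, by norm_num, by norm_num, by norm_num, by norm_num, ?_⟩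
  · intro c hc; simp at hc

/-- Weights and coefficient rows of the squares of block `cs53`. -/
noncomputable def cs53 : List (ℝ × List ℝ) :=
  [(228851423/43293270343680, [-257802088/686554269, 8114852/228851423, 1]),
   (14626584482911459/169846740419569149542400, [-360816965231686676/307158274141140639, 1]),
   (2074328955068001568231829/4787239032248607161649628132147200, [1])]

lemma cs53_nonneg : ∀ c ∈ cs53, (0:ℝ) ≤ c.1 := by
  simp only [cs53, List.forall_mem_cons]
  refine ⟨by norm_num, by norm_num, by norm_num, ?_⟩
  · intro c hc; simp at hc

/-- Weights and coefficient rows of the squares of block `cs17`. -/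
noncomputable def cs17 : List (ℝ × List ℝ) :=
  [(11685021/536870912, [14545768/11685021, -391394/3895007, -25432168/11685021, 163483/23370042, -1630214/3895007
      , 6784384/11685021, 7391021/23370042, -499345/23370042, 942205/11685021, -959966/3895007
      , 1882643/11685021, 1111164/3895007, -10527722/11685021, 1]),
   (82526531966051/6273347881009152, [350844357100496/82526531966051, -109852045730814/82526531966051, -144200946955268/82526531966051
      , 26148628291205/165053063932102, -98308544163348/82526531966051, 119722717424186/82526531966051
      , -172604042686735/82526531966051, -4584033770963/660212255728408, 46434472161128/82526531966051
      , -130846193067498/82526531966051, -47262162583877/82526531966051, 74010992765640/82526531966051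
      , 1]),
   (241146991199849057859245/3721711936388120086315008, [111808306575505718089553291/115750555775927547772437600
      , -53450587331633075491824/241146991199849057859245
      , -152329608516664364386944/241146991199849057859245
      , -3763622221159535709576/241146991199849057859245
      , 33884924078266215565296/241146991199849057859245
      , 41021779645059028131792/241146991199849057859245
      , -157690014737850745391493/241146991199849057859245
      , 2118153794624204510901/241146991199849057859245
      , 4964723146359049104696/241146991199849057859245
      , -88733536921607743499948959/115750555775927547772437600
      , -26123164479467790757596/241146991199849057859245, 1]),
   (135598795905241869789107263687/258929610183037875910467261562880, [-2111387599809855045235417550207/10847903672419349583128581094960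
      , -482147242323699400579341785182/135598795905241869789107263687
      , 66484238926566899105235370072/4675820548456616199624388403
      , 213548355409259683038456704992/135598795905241869789107263687
      , 312998876756319713963616418538/135598795905241869789107263687
      , -1350156934201408083228212602254/135598795905241869789107263687
      , 442361668934130707592289036961/135598795905241869789107263687
      , -150651379802960106728741180833/542395183620967479156429054748
      , 155176656264976769562481113743/135598795905241869789107263687
      , -40445480522597363119737104619357/10847903672419349583128581094960, 1]),
   (25138639644513586626451432666042123410829847/1408923679056749966591565512371889009747558400, [-81207087459550238424425538738972041455655683/25138639644513586626451432666042123410829847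
      , 36140760284269613947145930138477417133085440/25138639644513586626451432666042123410829847
      , -32282093747241459782655386693985022672327680/25138639644513586626451432666042123410829847
      , -8872280169943167667961782623433884035047680/25138639644513586626451432666042123410829847
      , 34275519158791783068764237510152763256288000/25138639644513586626451432666042123410829847
      , -193600869966874375288829355679767211265280/25138639644513586626451432666042123410829847
      , 7771199932855905717007410964450488603433440/25138639644513586626451432666042123410829847
      , 1710074971390004289281820775101731043131520/25138639644513586626451432666042123410829847
      , -14339699912479633618806833920791774184206720/25138639644513586626451432666042123410829847, 1]),
   (163700293179542518611583453702415140229298289589041969/136041740275284799689222558509576232357966808007961477120, [4999650858685565883006657665464820432623848512012311597/654801172718170074446333814809660560917193158356167876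
      , -1412506036795128735445373163993252704815178391833914259/327400586359085037223166907404830280458596579178083938
      , 444158702766011578690807606701882276683722856589548160/163700293179542518611583453702415140229298289589041969
      , 269710404693499500277390648115643068549232825065928960/163700293179542518611583453702415140229298289589041969
      , -1026843706940544853135216043038355740976161740907336800/163700293179542518611583453702415140229298289589041969
      , -56077692098218678421992754964864819540851757030819360/163700293179542518611583453702415140229298289589041969
      , 170636099967798972049840844918283888532820982645295860/163700293179542518611583453702415140229298289589041969
      , -31106090753762358137166550807343277594388704812347920/163700293179542518611583453702415140229298289589041969
      , 1]),
   (6182291787631034308421255082662895350107152397110754048287/5624699244413975789425778083412825148000720758509380294611566592, [-450408075381494320803079839391548624336446836452418955336/325383778296370226759013425403310281584586968268987055173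
      , 5225447507024722762632726829742437622324738305275901063552/108461259432123408919671141801103427194862322756329018391
      , 330038318679855594572552040083469226852877182880329412116160/6182291787631034308421255082662895350107152397110754048287
      , -81087076519891799876036873229665377010943057956658849186200/6182291787631034308421255082662895350107152397110754048287
      , -21156443786007770885999514411088869093223658857221026828768/2060763929210344769473751694220965116702384132370251349429
      , -4877444861389511546573959945747620490664997429269058737648/6182291787631034308421255082662895350107152397110754048287
      , -85347118293444981259122623711381388090545179692934980048640/2060763929210344769473751694220965116702384132370251349429
      , 1]),
   (214987486009953356099859763746211038686642337000473221619491500828997/3717383745908653753705257515983527696993296549779017093820917775073280, [-107896228584527661981853187969597404579836799523819835845097024619733/429974972019906712199719527492422077373284674000946443238983001657994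
      , 21234384665578328723969114161260607861870978422182889318577722779790/214987486009953356099859763746211038686642337000473221619491500828997
      , -129715763057855382047353623824345271859707412554361125757576409386643/429974972019906712199719527492422077373284674000946443238983001657994
      , 6435307501644270293632461824471522630907211310334578263506956362200/214987486009953356099859763746211038686642337000473221619491500828997
      , 36907401466943027989351910772031011761470489952048879877398883094363/859949944039813424399439054984844154746569348001892886477966003315988
      , -338359101289848522533963473763157657013732952902123913660105131587385/859949944039813424399439054984844154746569348001892886477966003315988
      , 1]),
   (3087093492629905062983256407124256922355313775265293808170922324724149930241021/413667171214979223330584228373365759072847194000787364074005316190303553559986176, [6929150194099527609970696099598836985625844424172541485562907154657526098464962/9261280477889715188949769221372770767065941325795881424512766974172449790723063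
      , 8827949053377011845842206063372872191136675722888083721102172132336773846348920/27783841433669145566849307664118312301197823977387644273538300922517349372169189
      , -94024433497034554228110319311191275045529222945917203471695494584285344125101134/27783841433669145566849307664118312301197823977387644273538300922517349372169189
      , -3539471128015970793702781535109781144410282384062534486672972154515451164717024/27783841433669145566849307664118312301197823977387644273538300922517349372169189
      , -20659880449794529045772023365481847440809374922914398030171716167051848507392871/138919207168345727834246538320591561505989119886938221367691504612586746860845945
      , 1]),
   (132548475414186920008327419826469525382777632167816509371760577320642098003461903714345709/26849405320843215036123260589966818401880810012080029525598953149764195247866379850114662400, [-4512606280551314978007253111088298886882049360723280091402062975638983675279677230987135475/3711357311597233760233167755141146710717773700698862262409296164977978744096933304001679852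
      , 265289810950619973135733792046996714780589406944939867554273847662179404509436158066991175/530193901656747680033309679305878101531110528671266037487042309282568392013847614857382836
      , -18826280130347100464529540400262409780916592705899046493520939804122843910670681153442098575/14845429246388935040932671020564586842871094802795449049637184659911914976387733216006719408
      , -21992283223085858128406470188501090597337439631571430327285466725862603202565635569221470/132548475414186920008327419826469525382777632167816509371760577320642098003461903714345709
      , 1]),
   (61508667557062853924300998866008243191444046403856128892962592163275989939953985626845515541913/1280905575836833970700152210583184364984261576552451355831325667452033512452815485278785428934098944, [33520085461677967779563369749886122240474764799501027836987408067447028881749897464381865741631947/3444485383195519819760855936496461618720866598615943218005905161143455436637423195103348870347128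
      , -78204516613000006398950818798924691831760137515843658349313358436355609442058802571663680817566429/9841386809130056627888159818561318910631047424616980622874014746124158390392637700295282486706080
      , 41700154405004174844788086401749205665647352464972107657727878517124940852049770886917529919204091/13777941532782079279043423745985846474883466394463772872023620644573821746549692780413395481388512
      , 1]),
   (218779913893230979707808360365296607790727283791173746205850301527621395075812829557677403098410760653606259/10651645492109845631706737367518223939930247243560649189580419921431900766649615639530111731518010427818639360, [-88283918230904479483974021047208327524990132271527772380916780297515961492688409313855657742011607026172524/218779913893230979707808360365296607790727283791173746205850301527621395075812829557677403098410760653606259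
      , -348674675961623212926124041057613666370531456092022311585339282186024282279393866141418572706444920360267463/3062918794505233715909317045114152509070181973076432446881904221386699531061379613807483643377750649150487626
      , 1]),
   (8276279758481647430145062178111772838114982583464944682930419578680503986384761260563293592004363330868811287109059819611/12376351998383662890675580971121371629710578666498613699542542485400653334574161642635552552891313944225182955584216681676800, [-114977691724524901064434562917143216589774817717622310628500771198767896824053205877872844171674970195476994540218984244000/24828839275444942290435186534335318514344947750394834048791258736041511959154283781689880776013089992606433861327179458833
      , 1]),
   (4041177100501133169473577443655466173817192419170598685651977761796606931858836556315940627047036792802527548033593896310398929837937/2149843302143235477798293429016216246195793926207615599870419407975767421717284419078930629589844907368774227109118656221271980643450880, [1])]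

lemma cs17_nonneg : ∀ c ∈ cs17, (0:ℝ) ≤ c.1 := by
  simp only [cs17, List.forall_mem_cons]
  refine ⟨by norm_num, by norm_num, by norm_num, by norm_num, by norm_num, by norm_num, by norm_num, by norm_num, by norm_num, by norm_num, by norm_num, by norm_num, by norm_num, by norm_num, ?_⟩
  · intro c hc; simp at hc

/-- Basis vector of the block, in reversed order. -/
def v8 {A : Type*} [CommRing A] (p1 p2 p3 p4 : A) : List A :=
  [p1^4, p1^2*p2, p2^2, p1*p3, p4, p1^3, p1*p2, p3, p1^2, p2, p1, 1]

/-- Basis vector of the block, in reversed order. -/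
def v62 {A : Type*} [CommRing A] (p1 p2 u v w z : A) : List A :=
  [z, w, p1*v, v, p1^2*u, p2*u, p1*u, u]

/-- Basis vector of the block, in reversed order. -/
def v53 {A : Type*} [CommRing A] (p1 u v : A) : List A :=
  [v, p1*u, u]

/-- Basis vector of the block, in reversed order. -/
def v17 {A : Type*} [CommRing A] (p1 p2 p3 a : A) : List A :=
  [a^3, p1*a^2, a^2, p1^2*a, p2*a, p1*a, a, p1^3, p1*p2, p3, p1^2, p2, p1, 1]

lemma block8 (p1 p2 p3 p4 : ℝ) : ldlR cs8 (v8 p1 p2 p3 p4) =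
    (11/1000) + (-11685021/536870912)*p1 + (268375/33554432)*p2 + (5263861/134217728)*p1*p1
    + (-36508496317/773094113280)*p3 + (-1272351/134217728)*p1*p2 + (-20312921/536870912)*p1*p1*p1
    + (-2419573/67108864)*p4 + (132154805651/2164663517184)*p1*p3 + (54038605/536870912)*p2*p2
    + (-2380051/134217728)*p1*p1*p2 + (22460267/1073741824)*p1*p1*p1*p1 + (1061131/67108864)*p1*p4
    + (-1874663153/541165879296)*p1*p1*p3 + (-415547/8388608)*p1*p2*p2
    + (3248405/536870912)*p1*p1*p1*p2 + (-12606747/2147483648)*p1*p1*p1*p1*p1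
    + (-1537559079181/10823317585920)*p2*p3 + (-2201549/67108864)*p2*p4
    + (8443811149/2705829396480)*p1*p2*p3 + (3895409/268435456)*p2*p2*p2
    + (7605473/536870912)*p1*p1*p2*p2 + (242225/536870912)*p1*p1*p1*p1*p2
    + (570485/33554432)*p1*p1*p4 + (-163236263/15032385536)*p1*p1*p1*p3
    + (6738427/8589934592)*p1*p1*p1*p1*p1*p1 + (16040531111/90194313216)*p3*p3
    + (-40090965397/1546188226560)*p3*p4 + (-865965267983/10823317585920)*p1*p3*p3
    + (-676659/16777216)*p2*p2*p3 + (13341701839/257698037760)*p1*p1*p2*p3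
    + (-1811003/1073741824)*p1*p1*p1*p1*p3 + (-824751/134217728)*p1*p2*p4
    + (1429757/268435456)*p1*p2*p2*p2 + (-25421421/2147483648)*p1*p1*p1*p2*p2
    + (5697153/4294967296)*p1*p1*p1*p1*p1*p2 + (-1341741/536870912)*p1*p1*p1*p4
    + (-966087/8589934592)*p1*p1*p1*p1*p1*p1*p1 + (939933585763/8658654068736)*p4*p4
    + (-133354581569/1202590842880)*p1*p3*p4 + (-3362385/134217728)*p2*p2*p4
    + (522247/16777216)*p1*p1*p2*p4 + (-4393495/2147483648)*p1*p1*p1*p1*p4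
    + (44809945729/1082331758592)*p1*p1*p3*p3 + (6542841/268435456)*p1*p2*p2*p3
    + (-7208851163/270582939648)*p1*p1*p1*p2*p3 + (19956678349/10823317585920)*p1*p1*p1*p1*p1*p3
    + (8279909/1073741824)*p2*p2*p2*p2 + (-5516471/536870912)*p1*p1*p2*p2*p2
    + (6020329573/1030792151040)*p1*p1*p1*p1*p2*p2 + (-3220499/4294967296)*p1*p1*p1*p1*p1*p1*p2
    + (4236773/137438953472)*p1*p1*p1*p1*p1*p1*p1*p1 := by
  simp only [ldlR, dotR, cs8, v8, List.map_cons, List.map_nil, List.sum_cons, List.sum_nil]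
  ring

noncomputable def c17_0 (p1 p2 p3 : ℝ) : ℝ :=
    (11685021/536870912) + (-5263861/134217728)*p1 + (833373/67108864)*p2
    + (20312921/536870912)*p1*p1 + (-1439949/134217728)*p3 + (4272701/268435456)*p1*p2
    + (-11981071/536870912)*p1*p1*p1 + (-4301551/134217728)*p1*p3 + (-3733655/268435456)*p1*p1*p2
    + (14643455/2147483648)*p1*p1*p1*p1 + (3479079151/45097156608)*p2*p2
    + (-1513244628629/10823317585920)*p2*p3 + (2274387/134217728)*p1*p2*p2
    + (-6757871/1073741824)*p1*p1*p1*p2 + (7789403/268435456)*p1*p1*p3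
    + (-61667/134217728)*p1*p1*p1*p1*p1 + (1056263715851/10823317585920)*p3*p3
    + (-3436385/67108864)*p1*p2*p3 + (1695661/536870912)*p1*p1*p1*p3
    + (65094164327/5411658792960)*p1*p1*p2*p2 + (-5002061/2147483648)*p1*p1*p1*p1*p2
    + (1572677/8589934592)*p1*p1*p1*p1*p1*p1
noncomputable def c17_1 (p1 p2 p3 : ℝ) : ℝ :=
    (7391021/536870912) + (-353641/8388608)*p1 + (-159323867/1073741824)*p2
    + (33302723/536870912)*p1*p1 + (770598197/45097156608)*p1*p2 + (-15103545/536870912)*p1*p1*p1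
    + (-1013065/67108864)*p2*p2 + (7684467/268435456)*p1*p1*p2 + (2095905/1073741824)*p1*p1*p1*p1
    + (4936099/33554432)*p3 + (-3022377/67108864)*p1*p3 + (5359611/67108864)*p2*p3
    + (-6409603/268435456)*p1*p1*p3 + (-1973409/33554432)*p1*p2*p2
    + (23210195/1073741824)*p1*p1*p1*p2 + (-9235803/4294967296)*p1*p1*p1*p1*p1
noncomputable def c17_2 (p1 p2 p3 : ℝ) : ℝ :=
    (47151566557/773094113280) + (-284965500947/2164663517184)*p1 + (60663500225/541165879296)*p1*p1
    + (-964834456979/10823317585920)*p2 + (-190549791641/1546188226560)*p1*p2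
    + (-1642615/536870912)*p1*p1*p1 + (60443/1048576)*p3 + (9651095/67108864)*p1*p3
    + (-590319089317/5411658792960)*p1*p1*p2 + (15427741/1073741824)*p1*p1*p1*p1
    + (1216433111099/10823317585920)*p2*p2
noncomputable def c17_3 (p1 p2 p3 : ℝ) : ℝ :=
    (135580647517/773094113280) + (-365962119251/2164663517184)*p1
    + (2674268750521/10823317585920)*p2 + (-20012595151/541165879296)*p1*p1
    + (-4342006683019/10823317585920)*p3 + (3500400663131/10823317585920)*p1*p2
    + (-333129124067/5411658792960)*p1*p1*p1
noncomputable def c17_4 (p1 p2 p3 : ℝ) : ℝ :=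
    (70628917597/773094113280) + (322524639877/2164663517184)*p1 + (-922407732949/2164663517184)*p2
    + (85296607639/450971566080)*p1*p1
noncomputable def c17_5 (p1 p2 p3 : ℝ) : ℝ :=
    (-174086762483/773094113280) + (-4800819437741/10823317585920)*p1
noncomputable def c17_6 (p1 p2 p3 : ℝ) : ℝ :=
    (53904909069/85899345920)

lemma block17 (p1 p2 p3 a : ℝ) : ldlR cs17 (v17 p1 p2 p3 a) =
    c17_0 p1 p2 p3 * a^0 + c17_1 p1 p2 p3 * a^1 + c17_2 p1 p2 p3 * a^2 + c17_3 p1 p2 p3 * a^3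
    + c17_4 p1 p2 p3 * a^4 + c17_5 p1 p2 p3 * a^5 + c17_6 p1 p2 p3 * a^6 := by
  simp only [ldlR, dotR, cs17, v17, c17_0, c17_1, c17_2, c17_3, c17_4, c17_5, c17_6, List.map_cons, List.map_nil, List.sum_cons, List.sum_nil]
  ring

noncomputable def c62_uu (p1 p2 : ℝ) : ℝ :=
    (500625/15032385536) + (-509177/22548578304)*p1 + (-1283/4831838208)*p2
    + (111598385/15152644620288)*p1*p1 + (-174271/118380036096)*p1*p2
    + (-2311769/3788161155072)*p1*p1*p1 + (9290923/3788161155072)*p2*p2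
    + (-3652093/7576322310144)*p1*p1*p2 + (3684647/30305289240576)*p1*p1*p1*p1
noncomputable def c62_uv (p1 p2 : ℝ) : ℝ :=
    (-805453/45097156608) + (78569/14797504512)*p1 + (-920807/473520144384)*p1*p1
    + (-1700653/473520144384)*p2 + (998267/1894080577536)*p1*p2 + (-4532089/7576322310144)*p1*p1*p1
noncomputable def c62_uw (p1 p2 : ℝ) : ℝ :=
    (-49634059/2525440770048) + (2100391213/227289669304320)*p1 + (86149571/10823317585920)*p2
    + (3841/45097156608)*p1*p1
noncomputable def c62_uz (p1 p2 : ℝ) : ℝ :=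
    (-326597/236760072192) + (1409081/315680096256)*p1 + (-4741327/947040288768)*p2
    + (3276883/3788161155072)*p1*p1
noncomputable def c62_vv (p1 p2 : ℝ) : ℝ :=
    (2044001/118380036096) + (-2489465/947040288768)*p1 + (444639/210453397504)*p1*p1
noncomputable def c62_vw (p1 p2 : ℝ) : ℝ :=
    (-5414932307/454579338608640) + (-535817/59190018048)*p1
noncomputable def c62_vz (p1 p2 : ℝ) : ℝ :=
    (-866311/157840048128) + (-224993/59190018048)*p1
noncomputable def c62_ww (p1 p2 : ℝ) : ℝ :=
    (188957863/7421703487488)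
noncomputable def c62_wz (p1 p2 : ℝ) : ℝ :=
    (-2209432223/909158677217280)
noncomputable def c62_zz (p1 p2 : ℝ) : ℝ :=
    (855775/105226698752)

lemma block62 (p1 p2 u v w z : ℝ) : ldlR cs62 (v62 p1 p2 u v w z) =
    c62_uu p1 p2 * (u * u) + c62_uv p1 p2 * (u * v) + c62_uw p1 p2 * (u * w)
    + c62_uz p1 p2 * (u * z) + c62_vv p1 p2 * (v * v) + c62_vw p1 p2 * (v * w)
    + c62_vz p1 p2 * (v * z) + c62_ww p1 p2 * (w * w) + c62_wz p1 p2 * (w * z)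
    + c62_zz p1 p2 * (z * z) := by
  simp only [ldlR, dotR, cs62, v62, c62_uu, c62_uv, c62_uw, c62_uz, c62_vv, c62_vw, c62_vz, c62_ww, c62_wz, c62_zz, List.map_cons, List.map_nil, List.sum_cons, List.sum_nil]
  ring

noncomputable def c53_uu (p1 : ℝ) : ℝ :=
    (228851423/43293270343680) + (2028713/5411658792960)*p1 + (481920491/5195192441241600)*p1*p1
noncomputable def c53_uv (p1 : ℝ) : ℝ :=
    (-32225261/8117488189440) + (-668403163/1948197165465600)*p1
noncomputable def c53_vv (p1 : ℝ) : ℝ :=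
    (40426294417/46756731971174400)

lemma block53 (p1 u v : ℝ) : ldlR cs53 (v53 p1 u v) =
    c53_uu p1 * (u * u) + c53_uv p1 * (u * v) + c53_vv p1 * (v * v) := by
  simp only [ldlR, dotR, cs53, v53, c53_uu, c53_uv, c53_vv, List.map_cons, List.map_nil, List.sum_cons, List.sum_nil]
  ring

lemma k62_uu (x : Fin 8 → ℝ) (p1 p2 p3 p4 p5 p6 p7 p8 : ℝ)
    (e1 : ps x 1 = p1) (e2 : ps x 2 = p2) (e3 : ps x 3 = p3) (e4 : ps x 4 = p4) (e5 : ps x 5 = p5) (e6 : ps x 6 = p6) (e7 : ps x 7 = p7) (e8 : ps x 8 = p8) :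
    S2 x (fun a b => w11 p1 p2 a b * w11 p1 p2 a b) =
    1806*p2*p2 + (-672)*p1*p1*p2 + 1176*p1*p3 + 42*p1*p1*p1*p1 + (-2352)*p4 := by
  have h1 : ∀ a b : ℝ, w11 p1 p2 a b * w11 p1 p2 a b =
        ev2 [(1*p1*p1*p1*p1 + (-2)*p1*p1*p2 + 1*p2*p2, 0, 0), ((-14)*p1*p1*p1 + 14*p1*p2, 0, 1)
        , (63*p1*p1 + (-14)*p2, 0, 2), ((-98)*p1, 0, 3), (49, 0, 4), ((-14)*p1*p1*p1 + 14*p1*p2, 1, 0)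
        , (182*p1*p1 + (-84)*p2, 1, 1), ((-686)*p1, 1, 2), (588, 1, 3), (63*p1*p1 + (-14)*p2, 2, 0)
        , ((-686)*p1, 2, 1), (1862, 2, 2), ((-98)*p1, 3, 0), (588, 3, 1), (49, 4, 0)] a b := by
    intro a b; simp only [ev1, ev2, ev3, List.map_cons, List.map_nil, List.sum_cons, List.sum_nil,
      w11]; ring
  have h2 : ∀ a : ℝ, w11 p1 p2 a a * w11 p1 p2 a a =
        ev1 [(1*p1*p1*p1*p1 + (-2)*p1*p1*p2 + 1*p2*p2, 0), ((-28)*p1*p1*p1 + 28*p1*p2, 1)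
        , (308*p1*p1 + (-112)*p2, 2), ((-1568)*p1, 3), (3136, 4)] a := by
    intro a; simp only [ev1, ev2, ev3, List.map_cons, List.map_nil, List.sum_cons, List.sum_nil,
      w11]; ring
  rw [S2_eq]
  simp only [h2]
  simp only [h1]
  simp only [sum_ev1, sum_ev2, List.map_cons, List.map_nil, List.sum_cons, List.sum_nil]
  rw [ps_zero]
  simp only [e1, e2, e3, e4, e5, e6, e7, e8]
  ring

lemma k62_uv (x : Fin 8 → ℝ) (p1 p2 p3 p4 p5 p6 p7 p8 : ℝ)
    (e1 : ps x 1 = p1) (e2 : ps x 2 = p2) (e3 : ps x 3 = p3) (e4 : ps x 4 = p4) (e5 : ps x 5 = p5) (e6 : ps x 6 = p6) (e7 : ps x 7 = p7) (e8 : ps x 8 = p8) :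
    S2 x (fun a b => w11 p1 p2 a b * w21 p1 p2 p3 a b) =
    4200*p2*p3 + (-672)*p1*p1*p3 + (-672)*p1*p2*p2 + 1764*p1*p4 + 84*p1*p1*p1*p2 + (-4704)*p5 := by
  have h1 : ∀ a b : ℝ, w11 p1 p2 a b * w21 p1 p2 p3 a b =
        ev2 [(2*p1*p1*p1*p2 + (-2)*p1*p1*p3 + (-2)*p1*p2*p2 + 2*p2*p3, 0, 0)
        , ((-21)*p1*p1*p2 + 14*p1*p3 + 7*p2*p2, 0, 1), (70*p1*p2 + (-14)*p3 + (-7)*p1*p1*p1, 0, 2)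
        , (63*p1*p1 + (-63)*p2, 0, 3), ((-147)*p1, 0, 4), (98, 0, 5)
        , ((-21)*p1*p1*p2 + 14*p1*p3 + 7*p2*p2, 1, 0), (182*p1*p2 + (-84)*p3, 1, 1)
        , ((-385)*p2 + 91*p1*p1, 1, 2), ((-686)*p1, 1, 3), (882, 1, 4)
        , (70*p1*p2 + (-14)*p3 + (-7)*p1*p1*p1, 2, 0), ((-385)*p2 + 91*p1*p1, 2, 1), ((-686)*p1, 2, 2)
        , (2156, 2, 3), (63*p1*p1 + (-63)*p2, 3, 0), ((-686)*p1, 3, 1), (2156, 3, 2), ((-147)*p1, 4, 0)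
        , (882, 4, 1), (98, 5, 0)] a b := by
    intro a b; simp only [ev1, ev2, ev3, List.map_cons, List.map_nil, List.sum_cons, List.sum_nil,
      w11, w21]; ring
  have h2 : ∀ a : ℝ, w11 p1 p2 a a * w21 p1 p2 p3 a a =
        ev1 [(2*p1*p1*p1*p2 + (-2)*p1*p1*p3 + (-2)*p1*p2*p2 + 2*p2*p3, 0)
        , ((-42)*p1*p1*p2 + 28*p1*p3 + 14*p2*p2, 1), (322*p1*p2 + (-112)*p3 + (-14)*p1*p1*p1, 2)
        , ((-896)*p2 + 308*p1*p1, 3), ((-2352)*p1, 4), (6272, 5)] a := by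
    intro a; simp only [ev1, ev2, ev3, List.map_cons, List.map_nil, List.sum_cons, List.sum_nil,
      w11, w21]; ring
  rw [S2_eq]
  simp only [h2]
  simp only [h1]
  simp only [sum_ev1, sum_ev2, List.map_cons, List.map_nil, List.sum_cons, List.sum_nil]
  rw [ps_zero]
  simp only [e1, e2, e3, e4, e5, e6, e7, e8]
  ring

lemma k62_uw (x : Fin 8 → ℝ) (p1 p2 p3 p4 p5 p6 p7 p8 : ℝ)
    (e1 : ps x 1 = p1) (e2 : ps x 2 = p2) (e3 : ps x 3 = p3) (e4 : ps x 4 = p4) (e5 : ps x 5 = p5) (e6 : ps x 6 = p6) (e7 : ps x 7 = p7) (e8 : ps x 8 = p8) :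
    S2 x (fun a b => w11 p1 p2 a b * w22 p2 p4 a b) =
    1764*p3*p3 + (-588)*p1*p2*p3 + 588*p1*p5 + 42*p1*p1*p2*p2 + (-42)*p1*p1*p4 + 630*p2*p4
    + (-2352)*p6 + (-42)*p2*p2*p2 := by
  have h1 : ∀ a b : ℝ, w11 p1 p2 a b * w22 p2 p4 a b =
        ev2 [(1*p1*p1*p2*p2 + (-1)*p1*p1*p4 + (-1)*p2*p2*p2 + 1*p2*p4, 0, 0), ((-7)*p1*p2*p2 + 7*p1*p4, 0, 1)
        , (14*p2*p2 + (-7)*p4 + (-7)*p1*p1*p2, 0, 2), (49*p1*p2, 0, 3), ((-56)*p2 + 7*p1*p1, 0, 4)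
        , ((-49)*p1, 0, 5), (49, 0, 6), ((-7)*p1*p2*p2 + 7*p1*p4, 1, 0), (42*p2*p2 + (-42)*p4, 1, 1)
        , (49*p1*p2, 1, 2), ((-294)*p2, 1, 3), ((-49)*p1, 1, 4), (294, 1, 5)
        , (14*p2*p2 + (-7)*p4 + (-7)*p1*p1*p2, 2, 0), (49*p1*p2, 2, 1), ((-140)*p2 + 42*p1*p1, 2, 2)
        , ((-294)*p1, 2, 3), (343, 2, 4), (49*p1*p2, 3, 0), ((-294)*p2, 3, 1), ((-294)*p1, 3, 2)
        , (1764, 3, 3), ((-56)*p2 + 7*p1*p1, 4, 0), ((-49)*p1, 4, 1), (343, 4, 2), ((-49)*p1, 5, 0)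
        , (294, 5, 1), (49, 6, 0)] a b := by
    intro a b; simp only [ev1, ev2, ev3, List.map_cons, List.map_nil, List.sum_cons, List.sum_nil,
      w11, w22]; ring
  have h2 : ∀ a : ℝ, w11 p1 p2 a a * w22 p2 p4 a a =
        ev1 [(1*p1*p1*p2*p2 + (-1)*p1*p1*p4 + (-1)*p2*p2*p2 + 1*p2*p4, 0), ((-14)*p1*p2*p2 + 14*p1*p4, 1)
        , (70*p2*p2 + (-56)*p4 + (-14)*p1*p1*p2, 2), (196*p1*p2, 3), ((-840)*p2 + 56*p1*p1, 4)
        , ((-784)*p1, 5), (3136, 6)] a := by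
    intro a; simp only [ev1, ev2, ev3, List.map_cons, List.map_nil, List.sum_cons, List.sum_nil,
      w11, w22]; ring
  rw [S2_eq]
  simp only [h2]
  simp only [h1]
  simp only [sum_ev1, sum_ev2, List.map_cons, List.map_nil, List.sum_cons, List.sum_nil]
  rw [ps_zero]
  simp only [e1, e2, e3, e4, e5, e6, e7, e8]
  ring

lemma k62_uz (x : Fin 8 → ℝ) (p1 p2 p3 p4 p5 p6 p7 p8 : ℝ)
    (e1 : ps x 1 = p1) (e2 : ps x 2 = p2) (e3 : ps x 3 = p3) (e4 : ps x 4 = p4) (e5 : ps x 5 = p5) (e6 : ps x 6 = p6) (e7 : ps x 7 = p7) (e8 : ps x 8 = p8) :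
    S2 x (fun a b => w11 p1 p2 a b * w31 p1 p3 p4 a b) =
    3612*p2*p4 + (-672)*p1*p1*p4 + (-672)*p1*p2*p3 + 1764*p1*p5 + 84*p1*p1*p1*p3 + 588*p3*p3
    + (-4704)*p6 := by
  have h1 : ∀ a b : ℝ, w11 p1 p2 a b * w31 p1 p3 p4 a b =
        ev2 [(2*p1*p1*p1*p3 + (-2)*p1*p1*p4 + (-2)*p1*p2*p3 + 2*p2*p4, 0, 0)
        , ((-21)*p1*p1*p3 + 14*p1*p4 + 7*p2*p3, 0, 1), (63*p1*p3 + (-14)*p4, 0, 2)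
        , ((-49)*p3 + (-7)*p1*p1*p1 + 7*p1*p2, 0, 3), (63*p1*p1 + (-14)*p2, 0, 4), ((-147)*p1, 0, 5)
        , (98, 0, 6), ((-21)*p1*p1*p3 + 14*p1*p4 + 7*p2*p3, 1, 0), (182*p1*p3 + (-84)*p4, 1, 1)
        , ((-343)*p3, 1, 2), (91*p1*p1 + (-42)*p2, 1, 3), ((-686)*p1, 1, 4), (882, 1, 5)
        , (63*p1*p3 + (-14)*p4, 2, 0), ((-343)*p3, 2, 1), ((-343)*p1, 2, 3), (1862, 2, 4)
        , ((-49)*p3 + (-7)*p1*p1*p1 + 7*p1*p2, 3, 0), (91*p1*p1 + (-42)*p2, 3, 1), ((-343)*p1, 3, 2)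
        , (588, 3, 3), (63*p1*p1 + (-14)*p2, 4, 0), ((-686)*p1, 4, 1), (1862, 4, 2), ((-147)*p1, 5, 0)
        , (882, 5, 1), (98, 6, 0)] a b := by
    intro a b; simp only [ev1, ev2, ev3, List.map_cons, List.map_nil, List.sum_cons, List.sum_nil,
      w11, w31]; ring
  have h2 : ∀ a : ℝ, w11 p1 p2 a a * w31 p1 p3 p4 a a =
        ev1 [(2*p1*p1*p1*p3 + (-2)*p1*p1*p4 + (-2)*p1*p2*p3 + 2*p2*p4, 0)
        , ((-42)*p1*p1*p3 + 28*p1*p4 + 14*p2*p3, 1), (308*p1*p3 + (-112)*p4, 2)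
        , ((-784)*p3 + (-14)*p1*p1*p1 + 14*p1*p2, 3), (308*p1*p1 + (-112)*p2, 4), ((-2352)*p1, 5)
        , (6272, 6)] a := by
    intro a; simp only [ev1, ev2, ev3, List.map_cons, List.map_nil, List.sum_cons, List.sum_nil,
      w11, w31]; ring
  rw [S2_eq]
  simp only [h2]
  simp only [h1]
  simp only [sum_ev1, sum_ev2, List.map_cons, List.map_nil, List.sum_cons, List.sum_nil]
  rw [ps_zero]
  simp only [e1, e2, e3, e4, e5, e6, e7, e8]
  ring

lemma k62_vv (x : Fin 8 → ℝ) (p1 p2 p3 p4 p5 p6 p7 p8 : ℝ)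
    (e1 : ps x 1 = p1) (e2 : ps x 2 = p2) (e3 : ps x 3 = p3) (e4 : ps x 4 = p4) (e5 : ps x 5 = p5) (e6 : ps x 6 = p6) (e7 : ps x 7 = p7) (e8 : ps x 8 = p8) :
    S2 x (fun a b => w21 p1 p2 p3 a b * w21 p1 p2 p3 a b) =
    5880*p2*p4 + 3696*p3*p3 + (-588)*p1*p1*p4 + (-1512)*p1*p2*p3 + 2352*p1*p5 + (-588)*p2*p2*p2
    + 168*p1*p1*p2*p2 + (-9408)*p6 := by
  have h1 : ∀ a b : ℝ, w21 p1 p2 p3 a b * w21 p1 p2 p3 a b =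
        ev2 [(4*p1*p1*p2*p2 + (-8)*p1*p2*p3 + 4*p3*p3, 0, 0), ((-28)*p1*p2*p2 + 28*p2*p3, 0, 1)
        , ((-28)*p1*p1*p2 + 28*p1*p3 + 49*p2*p2, 0, 2), (154*p1*p2 + (-56)*p3, 0, 3)
        , (49*p1*p1 + (-196)*p2, 0, 4), ((-196)*p1, 0, 5), (196, 0, 6)
        , ((-28)*p1*p2*p2 + 28*p2*p3, 1, 0), (98*p2*p2, 1, 1), (266*p1*p2 + (-168)*p3, 1, 2)
        , ((-784)*p2, 1, 3), ((-588)*p1, 1, 4), (1176, 1, 5)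
        , ((-28)*p1*p1*p2 + 28*p1*p3 + 49*p2*p2, 2, 0), (266*p1*p2 + (-168)*p3, 2, 1)
        , ((-1176)*p2 + 98*p1*p1, 2, 2), ((-784)*p1, 2, 3), (2940, 2, 4), (154*p1*p2 + (-56)*p3, 3, 0)
        , ((-784)*p2, 3, 1), ((-784)*p1, 3, 2), (3920, 3, 3), (49*p1*p1 + (-196)*p2, 4, 0)
        , ((-588)*p1, 4, 1), (2940, 4, 2), ((-196)*p1, 5, 0), (1176, 5, 1), (196, 6, 0)] a b := by
    intro a b; simp only [ev1, ev2, ev3, List.map_cons, List.map_nil, List.sum_cons, List.sum_nil,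
      w21]; ring
  have h2 : ∀ a : ℝ, w21 p1 p2 p3 a a * w21 p1 p2 p3 a a =
        ev1 [(4*p1*p1*p2*p2 + (-8)*p1*p2*p3 + 4*p3*p3, 0), ((-56)*p1*p2*p2 + 56*p2*p3, 1)
        , ((-56)*p1*p1*p2 + 56*p1*p3 + 196*p2*p2, 2), (840*p1*p2 + (-448)*p3, 3)
        , ((-3136)*p2 + 196*p1*p1, 4), ((-3136)*p1, 5), (12544, 6)] a := by
    intro a; simp only [ev1, ev2, ev3, List.map_cons, List.map_nil, List.sum_cons, List.sum_nil,
      w21]; ring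
  rw [S2_eq]
  simp only [h2]
  simp only [h1]
  simp only [sum_ev1, sum_ev2, List.map_cons, List.map_nil, List.sum_cons, List.sum_nil]
  rw [ps_zero]
  simp only [e1, e2, e3, e4, e5, e6, e7, e8]
  ring

lemma k62_vw (x : Fin 8 → ℝ) (p1 p2 p3 p4 p5 p6 p7 p8 : ℝ)
    (e1 : ps x 1 = p1) (e2 : ps x 2 = p2) (e3 : ps x 3 = p3) (e4 : ps x 4 = p4) (e5 : ps x 5 = p5) (e6 : ps x 6 = p6) (e7 : ps x 7 = p7) (e8 : ps x 8 = p8) :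
    S2 x (fun a b => w21 p1 p2 p3 a b * w22 p2 p4 a b) =
    3612*p3*p4 + (-672)*p1*p2*p4 + 588*p1*p6 + (-672)*p2*p2*p3 + 1764*p2*p5 + 84*p1*p2*p2*p2
    + (-4704)*p7 := by
  have h1 : ∀ a b : ℝ, w21 p1 p2 p3 a b * w22 p2 p4 a b =
        ev2 [(2*p1*p2*p2*p2 + (-2)*p1*p2*p4 + (-2)*p2*p2*p3 + 2*p3*p4, 0, 0), ((-7)*p2*p2*p2 + 7*p2*p4, 0, 1)
        , ((-21)*p1*p2*p2 + 7*p1*p4 + 14*p2*p3, 0, 2), (63*p2*p2 + (-14)*p4, 0, 3)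
        , (63*p1*p2 + (-14)*p3, 0, 4), ((-147)*p2, 0, 5), ((-49)*p1, 0, 6), (98, 0, 7)
        , ((-7)*p2*p2*p2 + 7*p2*p4, 1, 0), (91*p2*p2 + (-42)*p4, 1, 2), ((-343)*p2, 1, 4), (294, 1, 6)
        , ((-21)*p1*p2*p2 + 7*p1*p4 + 14*p2*p3, 2, 0), (91*p2*p2 + (-42)*p4, 2, 1)
        , (182*p1*p2 + (-84)*p3, 2, 2), ((-686)*p2, 2, 3), ((-343)*p1, 2, 4), (882, 2, 5)
        , (63*p2*p2 + (-14)*p4, 3, 0), ((-686)*p2, 3, 2), (1862, 3, 4), (63*p1*p2 + (-14)*p3, 4, 0)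
        , ((-343)*p2, 4, 1), ((-343)*p1, 4, 2), (1862, 4, 3), ((-147)*p2, 5, 0), (882, 5, 2)
        , ((-49)*p1, 6, 0), (294, 6, 1), (98, 7, 0)] a b := by
    intro a b; simp only [ev1, ev2, ev3, List.map_cons, List.map_nil, List.sum_cons, List.sum_nil,
      w21, w22]; ring
  have h2 : ∀ a : ℝ, w21 p1 p2 p3 a a * w22 p2 p4 a a =
        ev1 [(2*p1*p2*p2*p2 + (-2)*p1*p2*p4 + (-2)*p2*p2*p3 + 2*p3*p4, 0), ((-14)*p2*p2*p2 + 14*p2*p4, 1)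
        , ((-42)*p1*p2*p2 + 14*p1*p4 + 28*p2*p3, 2), (308*p2*p2 + (-112)*p4, 3)
        , (308*p1*p2 + (-112)*p3, 4), ((-2352)*p2, 5), ((-784)*p1, 6), (6272, 7)] a := by
    intro a; simp only [ev1, ev2, ev3, List.map_cons, List.map_nil, List.sum_cons, List.sum_nil,
      w21, w22]; ring
  rw [S2_eq]
  simp only [h2]
  simp only [h1]
  simp only [sum_ev1, sum_ev2, List.map_cons, List.map_nil, List.sum_cons, List.sum_nil]
  rw [ps_zero]
  simp only [e1, e2, e3, e4, e5, e6, e7, e8]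
  ring

lemma k62_vz (x : Fin 8 → ℝ) (p1 p2 p3 p4 p5 p6 p7 p8 : ℝ)
    (e1 : ps x 1 = p1) (e2 : ps x 2 = p2) (e3 : ps x 3 = p3) (e4 : ps x 4 = p4) (e5 : ps x 5 = p5) (e6 : ps x 6 = p6) (e7 : ps x 7 = p7) (e8 : ps x 8 = p8) :
    S2 x (fun a b => w21 p1 p2 p3 a b * w31 p1 p3 p4 a b) =
    4704*p2*p5 + 4872*p3*p4 + (-588)*p1*p1*p5 + (-756)*p1*p3*p3 + 2352*p1*p6 + (-756)*p1*p2*p4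
    + (-588)*p2*p2*p3 + 168*p1*p1*p2*p3 + (-9408)*p7 := by
  have h1 : ∀ a b : ℝ, w21 p1 p2 p3 a b * w31 p1 p3 p4 a b =
        ev2 [(4*p1*p1*p2*p3 + (-4)*p1*p2*p4 + (-4)*p1*p3*p3 + 4*p3*p4, 0, 0)
        , ((-28)*p1*p2*p3 + 14*p2*p4 + 14*p3*p3, 0, 1), ((-14)*p1*p1*p3 + 14*p1*p4 + 49*p2*p3, 0, 2)
        , (91*p1*p3 + (-28)*p4 + (-14)*p1*p1*p2, 0, 3), (77*p1*p2 + (-126)*p3, 0, 4)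
        , (49*p1*p1 + (-98)*p2, 0, 5), ((-196)*p1, 0, 6), (196, 0, 7)
        , ((-28)*p1*p2*p3 + 14*p2*p4 + 14*p3*p3, 1, 0), (98*p2*p3, 1, 1), (133*p1*p3 + (-84)*p4, 1, 2)
        , ((-476)*p3 + 133*p1*p2, 1, 3), ((-392)*p2, 1, 4), ((-588)*p1, 1, 5), (1176, 1, 6)
        , ((-14)*p1*p1*p3 + 14*p1*p4 + 49*p2*p3, 2, 0), (133*p1*p3 + (-84)*p4, 2, 1), ((-588)*p3, 2, 2)
        , (49*p1*p1 + (-294)*p2, 2, 3), ((-392)*p1, 2, 4), (2352, 2, 5)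
        , (91*p1*p3 + (-28)*p4 + (-14)*p1*p1*p2, 3, 0), ((-476)*p3 + 133*p1*p2, 3, 1)
        , (49*p1*p1 + (-294)*p2, 3, 2), ((-784)*p1, 3, 3), (2548, 3, 4), (77*p1*p2 + (-126)*p3, 4, 0)
        , ((-392)*p2, 4, 1), ((-392)*p1, 4, 2), (2548, 4, 3), (49*p1*p1 + (-98)*p2, 5, 0)
        , ((-588)*p1, 5, 1), (2352, 5, 2), ((-196)*p1, 6, 0), (1176, 6, 1), (196, 7, 0)] a b := by
    intro a b; simp only [ev1, ev2, ev3, List.map_cons, List.map_nil, List.sum_cons, List.sum_nil,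
      w21, w31]; ring
  have h2 : ∀ a : ℝ, w21 p1 p2 p3 a a * w31 p1 p3 p4 a a =
        ev1 [(4*p1*p1*p2*p3 + (-4)*p1*p2*p4 + (-4)*p1*p3*p3 + 4*p3*p4, 0)
        , ((-56)*p1*p2*p3 + 28*p2*p4 + 28*p3*p3, 1), ((-28)*p1*p1*p3 + 28*p1*p4 + 196*p2*p3, 2)
        , (448*p1*p3 + (-224)*p4 + (-28)*p1*p1*p2, 3), ((-1792)*p3 + 420*p1*p2, 4)
        , (196*p1*p1 + (-1568)*p2, 5), ((-3136)*p1, 6), (12544, 7)] a := by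
    intro a; simp only [ev1, ev2, ev3, List.map_cons, List.map_nil, List.sum_cons, List.sum_nil,
      w21, w31]; ring
  rw [S2_eq]
  simp only [h2]
  simp only [h1]
  simp only [sum_ev1, sum_ev2, List.map_cons, List.map_nil, List.sum_cons, List.sum_nil]
  rw [ps_zero]
  simp only [e1, e2, e3, e4, e5, e6, e7, e8]
  ring

lemma k62_ww (x : Fin 8 → ℝ) (p1 p2 p3 p4 p5 p6 p7 p8 : ℝ)
    (e1 : ps x 1 = p1) (e2 : ps x 2 = p2) (e3 : ps x 3 = p3) (e4 : ps x 4 = p4) (e5 : ps x 5 = p5) (e6 : ps x 6 = p6) (e7 : ps x 7 = p7) (e8 : ps x 8 = p8) :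
    S2 x (fun a b => w22 p2 p4 a b * w22 p2 p4 a b) =
    1806*p4*p4 + (-672)*p2*p2*p4 + 1176*p2*p6 + 42*p2*p2*p2*p2 + (-2352)*p8 := by
  have h1 : ∀ a b : ℝ, w22 p2 p4 a b * w22 p2 p4 a b =
        ev2 [(1*p2*p2*p2*p2 + (-2)*p2*p2*p4 + 1*p4*p4, 0, 0), ((-14)*p2*p2*p2 + 14*p2*p4, 0, 2)
        , (63*p2*p2 + (-14)*p4, 0, 4), ((-98)*p2, 0, 6), (49, 0, 8), ((-14)*p2*p2*p2 + 14*p2*p4, 2, 0)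
        , (182*p2*p2 + (-84)*p4, 2, 2), ((-686)*p2, 2, 4), (588, 2, 6), (63*p2*p2 + (-14)*p4, 4, 0)
        , ((-686)*p2, 4, 2), (1862, 4, 4), ((-98)*p2, 6, 0), (588, 6, 2), (49, 8, 0)] a b := by
    intro a b; simp only [ev1, ev2, ev3, List.map_cons, List.map_nil, List.sum_cons, List.sum_nil,
      w22]; ring
  have h2 : ∀ a : ℝ, w22 p2 p4 a a * w22 p2 p4 a a =
        ev1 [(1*p2*p2*p2*p2 + (-2)*p2*p2*p4 + 1*p4*p4, 0), ((-28)*p2*p2*p2 + 28*p2*p4, 2)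
        , (308*p2*p2 + (-112)*p4, 4), ((-1568)*p2, 6), (3136, 8)] a := by
    intro a; simp only [ev1, ev2, ev3, List.map_cons, List.map_nil, List.sum_cons, List.sum_nil,
      w22]; ring
  rw [S2_eq]
  simp only [h2]
  simp only [h1]
  simp only [sum_ev1, sum_ev2, List.map_cons, List.map_nil, List.sum_cons, List.sum_nil]
  rw [ps_zero]
  simp only [e1, e2, e3, e4, e5, e6, e7, e8]
  ring

lemma k62_wz (x : Fin 8 → ℝ) (p1 p2 p3 p4 p5 p6 p7 p8 : ℝ)
    (e1 : ps x 1 = p1) (e2 : ps x 2 = p2) (e3 : ps x 3 = p3) (e4 : ps x 4 = p4) (e5 : ps x 5 = p5) (e6 : ps x 6 = p6) (e7 : ps x 7 = p7) (e8 : ps x 8 = p8) :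
    S2 x (fun a b => w22 p2 p4 a b * w31 p1 p3 p4 a b) =
    4116*p3*p5 + (-588)*p1*p2*p5 + (-588)*p2*p3*p3 + 1176*p2*p6 + 84*p1*p2*p2*p3 + (-84)*p2*p2*p4
    + 588*p1*p7 + (-4704)*p8 + (-84)*p1*p3*p4 + 84*p4*p4 := by
  have h1 : ∀ a b : ℝ, w22 p2 p4 a b * w31 p1 p3 p4 a b =
        ev2 [(2*p1*p2*p2*p3 + (-2)*p2*p2*p4 + (-2)*p1*p3*p4 + 2*p4*p4, 0, 0), ((-7)*p2*p2*p3 + 7*p3*p4, 0, 1)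
        , ((-14)*p1*p2*p3 + 14*p2*p4, 0, 2), (49*p2*p3 + (-7)*p1*p2*p2 + 7*p1*p4, 0, 3)
        , (14*p1*p3 + (-28)*p4 + 14*p2*p2, 0, 4), (49*p1*p2 + (-49)*p3, 0, 5), ((-98)*p2, 0, 6)
        , ((-49)*p1, 0, 7), (98, 0, 8), ((-7)*p2*p2*p3 + 7*p3*p4, 1, 0), (49*p2*p3, 1, 2)
        , (42*p2*p2 + (-42)*p4, 1, 3), ((-49)*p3, 1, 4), ((-294)*p2, 1, 5), (294, 1, 7)
        , ((-14)*p1*p2*p3 + 14*p2*p4, 2, 0), (49*p2*p3, 2, 1), (84*p1*p3 + (-84)*p4, 2, 2)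
        , ((-294)*p3 + 49*p1*p2, 2, 3), ((-98)*p2, 2, 4), ((-294)*p1, 2, 5), (588, 2, 6)
        , (49*p2*p3 + (-7)*p1*p2*p2 + 7*p1*p4, 3, 0), (42*p2*p2 + (-42)*p4, 3, 1)
        , ((-294)*p3 + 49*p1*p2, 3, 2), ((-588)*p2, 3, 3), ((-49)*p1, 3, 4), (2058, 3, 5)
        , (14*p1*p3 + (-28)*p4 + 14*p2*p2, 4, 0), ((-49)*p3, 4, 1), ((-98)*p2, 4, 2), ((-49)*p1, 4, 3)
        , (196, 4, 4), (49*p1*p2 + (-49)*p3, 5, 0), ((-294)*p2, 5, 1), ((-294)*p1, 5, 2), (2058, 5, 3)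
        , ((-98)*p2, 6, 0), (588, 6, 2), ((-49)*p1, 7, 0), (294, 7, 1), (98, 8, 0)] a b := by
    intro a b; simp only [ev1, ev2, ev3, List.map_cons, List.map_nil, List.sum_cons, List.sum_nil,
      w22, w31]; ring
  have h2 : ∀ a : ℝ, w22 p2 p4 a a * w31 p1 p3 p4 a a =
        ev1 [(2*p1*p2*p2*p3 + (-2)*p2*p2*p4 + (-2)*p1*p3*p4 + 2*p4*p4, 0), ((-14)*p2*p2*p3 + 14*p3*p4, 1)
        , ((-28)*p1*p2*p3 + 28*p2*p4, 2), (196*p2*p3 + (-14)*p1*p2*p2 + 14*p1*p4, 3)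
        , (112*p1*p3 + (-224)*p4 + 112*p2*p2, 4), ((-784)*p3 + 196*p1*p2, 5), ((-1568)*p2, 6)
        , ((-784)*p1, 7), (6272, 8)] a := by
    intro a; simp only [ev1, ev2, ev3, List.map_cons, List.map_nil, List.sum_cons, List.sum_nil,
      w22, w31]; ring
  rw [S2_eq]
  simp only [h2]
  simp only [h1]
  simp only [sum_ev1, sum_ev2, List.map_cons, List.map_nil, List.sum_cons, List.sum_nil]
  rw [ps_zero]
  simp only [e1, e2, e3, e4, e5, e6, e7, e8]
  ring

lemma k62_zz (x : Fin 8 → ℝ) (p1 p2 p3 p4 p5 p6 p7 p8 : ℝ)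
    (e1 : ps x 1 = p1) (e2 : ps x 2 = p2) (e3 : ps x 3 = p3) (e4 : ps x 4 = p4) (e5 : ps x 5 = p5) (e6 : ps x 6 = p6) (e7 : ps x 7 = p7) (e8 : ps x 8 = p8) :
    S2 x (fun a b => w31 p1 p3 p4 a b * w31 p1 p3 p4 a b) =
    3528*p2*p6 + 3696*p4*p4 + (-588)*p1*p1*p6 + (-1512)*p1*p3*p4 + 2352*p1*p7 + (-588)*p2*p3*p3
    + 2352*p3*p5 + 168*p1*p1*p3*p3 + (-9408)*p8 := by
  have h1 : ∀ a b : ℝ, w31 p1 p3 p4 a b * w31 p1 p3 p4 a b =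
        ev2 [(4*p1*p1*p3*p3 + (-8)*p1*p3*p4 + 4*p4*p4, 0, 0), ((-28)*p1*p3*p3 + 28*p3*p4, 0, 1)
        , (49*p3*p3, 0, 2), ((-28)*p1*p1*p3 + 28*p1*p4, 0, 3), (154*p1*p3 + (-56)*p4, 0, 4)
        , ((-196)*p3, 0, 5), (49*p1*p1, 0, 6), ((-196)*p1, 0, 7), (196, 0, 8)
        , ((-28)*p1*p3*p3 + 28*p3*p4, 1, 0), (98*p3*p3, 1, 1), (266*p1*p3 + (-168)*p4, 1, 3)
        , ((-784)*p3, 1, 4), ((-588)*p1, 1, 6), (1176, 1, 7), (49*p3*p3, 2, 0), ((-588)*p3, 2, 3)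
        , (1764, 2, 6), ((-28)*p1*p1*p3 + 28*p1*p4, 3, 0), (266*p1*p3 + (-168)*p4, 3, 1)
        , ((-588)*p3, 3, 2), (98*p1*p1, 3, 3), ((-784)*p1, 3, 4), (1176, 3, 5)
        , (154*p1*p3 + (-56)*p4, 4, 0), ((-784)*p3, 4, 1), ((-784)*p1, 4, 3), (3920, 4, 4)
        , ((-196)*p3, 5, 0), (1176, 5, 3), (49*p1*p1, 6, 0), ((-588)*p1, 6, 1), (1764, 6, 2)
        , ((-196)*p1, 7, 0), (1176, 7, 1), (196, 8, 0)] a b := by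
    intro a b; simp only [ev1, ev2, ev3, List.map_cons, List.map_nil, List.sum_cons, List.sum_nil,
      w31]; ring
  have h2 : ∀ a : ℝ, w31 p1 p3 p4 a a * w31 p1 p3 p4 a a =
        ev1 [(4*p1*p1*p3*p3 + (-8)*p1*p3*p4 + 4*p4*p4, 0), ((-56)*p1*p3*p3 + 56*p3*p4, 1), (196*p3*p3, 2)
        , ((-56)*p1*p1*p3 + 56*p1*p4, 3), (840*p1*p3 + (-448)*p4, 4), ((-3136)*p3, 5), (196*p1*p1, 6)
        , ((-3136)*p1, 7), (12544, 8)] a := by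
    intro a; simp only [ev1, ev2, ev3, List.map_cons, List.map_nil, List.sum_cons, List.sum_nil,
      w31]; ring
  rw [S2_eq]
  simp only [h2]
  simp only [h1]
  simp only [sum_ev1, sum_ev2, List.map_cons, List.map_nil, List.sum_cons, List.sum_nil]
  rw [ps_zero]
  simp only [e1, e2, e3, e4, e5, e6, e7, e8]
  ring

set_option maxRecDepth 10000 in
set_option maxHeartbeats 4000000 in
lemma k53_uu (x : Fin 8 → ℝ) (p1 p2 p3 p4 p5 p6 p7 p8 : ℝ)
    (e1 : ps x 1 = p1) (e2 : ps x 2 = p2) (e3 : ps x 3 = p3) (e4 : ps x 4 = p4) (e5 : ps x 5 = p5) (e6 : ps x 6 = p6) (e7 : ps x 7 = p7) (e8 : ps x 8 = p8) :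
    S3 x (fun a b c => w111 p1 p2 p3 a b c * w111 p1 p2 p3 a b c) =
    16560*p2*p2*p2 + (-16200)*p1*p1*p2*p2 + 53280*p1*p2*p3 + 2880*p1*p1*p1*p1*p2
    + (-9120)*p1*p1*p1*p3 + 28080*p1*p1*p4 + (-120)*p1*p1*p1*p1*p1*p1 + (-73440)*p2*p4
    + (-22080)*p3*p3 + (-60480)*p1*p5 + 80640*p6 := by
  have h1 : ∀ a b c : ℝ, w111 p1 p2 p3 a b c * w111 p1 p2 p3 a b c =
        ev3 [(1*p1*p1*p1*p1*p1*p1 + (-6)*p1*p1*p1*p1*p2 + 4*p1*p1*p1*p3 + 9*p1*p1*p2*p2 + (-12)*p1*p2*p3 + 4*p3*p3, 0, 0, 0)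
        , ((-12)*p1*p1*p1*p1*p1 + 48*p1*p1*p1*p2 + (-24)*p1*p1*p3 + (-36)*p1*p2*p2 + 24*p2*p3, 0, 0, 1)
        , (60*p1*p1*p1*p1 + (-144)*p1*p1*p2 + 48*p1*p3 + 36*p2*p2, 0, 0, 2)
        , ((-168)*p1*p1*p1 + 216*p1*p2 + (-48)*p3, 0, 0, 3), (288*p1*p1 + (-144)*p2, 0, 0, 4)
        , ((-288)*p1, 0, 0, 5), (144, 0, 0, 6)
        , ((-12)*p1*p1*p1*p1*p1 + 48*p1*p1*p1*p2 + (-24)*p1*p1*p3 + (-36)*p1*p2*p2 + 24*p2*p3, 0, 1, 0)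
        , (132*p1*p1*p1*p1 + (-324)*p1*p1*p2 + 120*p1*p3 + 72*p2*p2, 0, 1, 1)
        , ((-564)*p1*p1*p1 + 684*p1*p2 + (-120)*p3, 0, 1, 2), (1224*p1*p1 + (-504)*p2, 0, 1, 3)
        , ((-1440)*p1, 0, 1, 4), (720, 0, 1, 5)
        , (60*p1*p1*p1*p1 + (-144)*p1*p1*p2 + 48*p1*p3 + 36*p2*p2, 0, 2, 0)
        , ((-564)*p1*p1*p1 + 684*p1*p2 + (-120)*p3, 0, 2, 1), (1908*p1*p1 + (-720)*p2, 0, 2, 2)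
        , ((-2808)*p1, 0, 2, 3), (1620, 0, 2, 4), ((-168)*p1*p1*p1 + 216*p1*p2 + (-48)*p3, 0, 3, 0)
        , (1224*p1*p1 + (-504)*p2, 0, 3, 1), ((-2808)*p1, 0, 3, 2), (2088, 0, 3, 3)
        , (288*p1*p1 + (-144)*p2, 0, 4, 0), ((-1440)*p1, 0, 4, 1), (1620, 0, 4, 2), ((-288)*p1, 0, 5, 0)
        , (720, 0, 5, 1), (144, 0, 6, 0)
        , ((-12)*p1*p1*p1*p1*p1 + 48*p1*p1*p1*p2 + (-24)*p1*p1*p3 + (-36)*p1*p2*p2 + 24*p2*p3, 1, 0, 0)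
        , (132*p1*p1*p1*p1 + (-324)*p1*p1*p2 + 120*p1*p3 + 72*p2*p2, 1, 0, 1)
        , ((-564)*p1*p1*p1 + 684*p1*p2 + (-120)*p3, 1, 0, 2), (1224*p1*p1 + (-504)*p2, 1, 0, 3)
        , ((-1440)*p1, 1, 0, 4), (720, 1, 0, 5)
        , (132*p1*p1*p1*p1 + (-324)*p1*p1*p2 + 120*p1*p3 + 72*p2*p2, 1, 1, 0)
        , ((-1320)*p1*p1*p1 + 1800*p1*p2 + (-480)*p3, 1, 1, 1), (4680*p1*p1 + (-2160)*p2, 1, 1, 2)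
        , ((-7200)*p1, 1, 1, 3), (4680, 1, 1, 4), ((-564)*p1*p1*p1 + 684*p1*p2 + (-120)*p3, 1, 2, 0)
        , (4680*p1*p1 + (-2160)*p2, 1, 2, 1), ((-12240)*p1, 1, 2, 2), (9720, 1, 2, 3)
        , (1224*p1*p1 + (-504)*p2, 1, 3, 0), ((-7200)*p1, 1, 3, 1), (9720, 1, 3, 2)
        , ((-1440)*p1, 1, 4, 0), (4680, 1, 4, 1), (720, 1, 5, 0)
        , (60*p1*p1*p1*p1 + (-144)*p1*p1*p2 + 48*p1*p3 + 36*p2*p2, 2, 0, 0)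
        , ((-564)*p1*p1*p1 + 684*p1*p2 + (-120)*p3, 2, 0, 1), (1908*p1*p1 + (-720)*p2, 2, 0, 2)
        , ((-2808)*p1, 2, 0, 3), (1620, 2, 0, 4), ((-564)*p1*p1*p1 + 684*p1*p2 + (-120)*p3, 2, 1, 0)
        , (4680*p1*p1 + (-2160)*p2, 2, 1, 1), ((-12240)*p1, 2, 1, 2), (9720, 2, 1, 3)
        , (1908*p1*p1 + (-720)*p2, 2, 2, 0), ((-12240)*p1, 2, 2, 1), (19800, 2, 2, 2)
        , ((-2808)*p1, 2, 3, 0), (9720, 2, 3, 1), (1620, 2, 4, 0)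
        , ((-168)*p1*p1*p1 + 216*p1*p2 + (-48)*p3, 3, 0, 0), (1224*p1*p1 + (-504)*p2, 3, 0, 1)
        , ((-2808)*p1, 3, 0, 2), (2088, 3, 0, 3), (1224*p1*p1 + (-504)*p2, 3, 1, 0)
        , ((-7200)*p1, 3, 1, 1), (9720, 3, 1, 2), ((-2808)*p1, 3, 2, 0), (9720, 3, 2, 1)
        , (2088, 3, 3, 0), (288*p1*p1 + (-144)*p2, 4, 0, 0), ((-1440)*p1, 4, 0, 1), (1620, 4, 0, 2)
        , ((-1440)*p1, 4, 1, 0), (4680, 4, 1, 1), (1620, 4, 2, 0), ((-288)*p1, 5, 0, 0), (720, 5, 0, 1)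
        , (720, 5, 1, 0), (144, 6, 0, 0)] a b c := by
    intro a b c; simp only [ev1, ev2, ev3, List.map_cons, List.map_nil, List.sum_cons, List.sum_nil,
      w111]; ring
  have h2 : ∀ a b : ℝ, w111 p1 p2 p3 a a b * w111 p1 p2 p3 a a b =
        ev2 [(1*p1*p1*p1*p1*p1*p1 + (-6)*p1*p1*p1*p1*p2 + 4*p1*p1*p1*p3 + 9*p1*p1*p2*p2 + (-12)*p1*p2*p3 + 4*p3*p3, 0, 0)
        , ((-12)*p1*p1*p1*p1*p1 + 48*p1*p1*p1*p2 + (-24)*p1*p1*p3 + (-36)*p1*p2*p2 + 24*p2*p3, 0, 1)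
        , (60*p1*p1*p1*p1 + (-144)*p1*p1*p2 + 48*p1*p3 + 36*p2*p2, 0, 2)
        , ((-168)*p1*p1*p1 + 216*p1*p2 + (-48)*p3, 0, 3), (288*p1*p1 + (-144)*p2, 0, 4)
        , ((-288)*p1, 0, 5), (144, 0, 6)
        , ((-24)*p1*p1*p1*p1*p1 + 96*p1*p1*p1*p2 + (-48)*p1*p1*p3 + (-72)*p1*p2*p2 + 48*p2*p3, 1, 0)
        , (264*p1*p1*p1*p1 + (-648)*p1*p1*p2 + 240*p1*p3 + 144*p2*p2, 1, 1)
        , ((-1128)*p1*p1*p1 + 1368*p1*p2 + (-240)*p3, 1, 2), (2448*p1*p1 + (-1008)*p2, 1, 3)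
        , ((-2880)*p1, 1, 4), (1440, 1, 5)
        , (252*p1*p1*p1*p1 + (-612)*p1*p1*p2 + 216*p1*p3 + 144*p2*p2, 2, 0)
        , ((-2448)*p1*p1*p1 + 3168*p1*p2 + (-720)*p3, 2, 1), (8496*p1*p1 + (-3600)*p2, 2, 2)
        , ((-12816)*p1, 2, 3), (7920, 2, 4), ((-1464)*p1*p1*p1 + 1800*p1*p2 + (-336)*p3, 3, 0)
        , (11808*p1*p1 + (-5328)*p2, 3, 1), ((-30096)*p1, 3, 2), (23616, 3, 3)
        , (4932*p1*p1 + (-2016)*p2, 4, 0), ((-29520)*p1, 4, 1), (42480, 4, 2), ((-9072)*p1, 5, 0)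
        , (30240, 5, 1), (7056, 6, 0)] a b := by
    intro a b; simp only [ev1, ev2, ev3, List.map_cons, List.map_nil, List.sum_cons, List.sum_nil,
      w111]; ring
  have h3 : ∀ a : ℝ, w111 p1 p2 p3 a a a * w111 p1 p2 p3 a a a =
        ev1 [(1*p1*p1*p1*p1*p1*p1 + (-6)*p1*p1*p1*p1*p2 + 4*p1*p1*p1*p3 + 9*p1*p1*p2*p2 + (-12)*p1*p2*p3 + 4*p3*p3, 0)
        , ((-36)*p1*p1*p1*p1*p1 + 144*p1*p1*p1*p2 + (-72)*p1*p1*p3 + (-108)*p1*p2*p2 + 72*p2*p3, 1)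
        , (576*p1*p1*p1*p1 + (-1404)*p1*p1*p2 + 504*p1*p3 + 324*p2*p2, 2)
        , ((-5208)*p1*p1*p1 + 6552*p1*p2 + (-1344)*p3, 3), (27972*p1*p1 + (-12096)*p2, 4)
        , ((-84672)*p1, 5), (112896, 6)] a := by
    intro a; simp only [ev1, ev2, ev3, List.map_cons, List.map_nil, List.sum_cons, List.sum_nil,
      w111]; ring
  rw [S3_eq]
  · simp only [h3]
    simp only [h2]
    simp only [h1]
    simp only [sum_ev1, sum_ev2, sum_ev3, List.map_cons, List.map_nil, List.sum_cons,
      List.sum_nil]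
    rw [ps_zero]
    simp only [e1, e2, e3, e4, e5, e6, e7, e8]
    ring
  · intro a b; simp only [w111]; ring
  · intro a b; simp only [w111]; ring

set_option maxRecDepth 10000 in
set_option maxHeartbeats 4000000 in
lemma k53_uv (x : Fin 8 → ℝ) (p1 p2 p3 p4 p5 p6 p7 p8 : ℝ)
    (e1 : ps x 1 = p1) (e2 : ps x 2 = p2) (e3 : ps x 3 = p3) (e4 : ps x 4 = p4) (e5 : ps x 5 = p5) (e6 : ps x 6 = p6) (e7 : ps x 7 = p7) (e8 : ps x 8 = p8) :
    S3 x (fun a b c => w111 p1 p2 p3 a b c * w211 p1 p2 p3 p4 a b c) =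
    76320*p2*p2*p3 + (-46080)*p1*p1*p2*p3 + (-16200)*p1*p2*p2*p2 + 108000*p1*p2*p4 + 53280*p1*p3*p3
    + 2880*p1*p1*p1*p1*p3 + 5760*p1*p1*p1*p2*p2 + (-13680)*p1*p1*p1*p4 + 56160*p1*p1*p5
    + (-360)*p1*p1*p1*p1*p1*p2 + (-177120)*p2*p5 + (-139680)*p3*p4 + (-151200)*p1*p6 + 241920*p7 := by
  have h1 : ∀ a b c : ℝ, w111 p1 p2 p3 a b c * w211 p1 p2 p3 p4 a b c =
        ev3 [(3*p1*p1*p1*p1*p1*p2 + (-6)*p1*p1*p1*p1*p3 + (-12)*p1*p1*p1*p2*p2 + 6*p1*p1*p1*p4 + 24*p1*p1*p2*p3 + 9*p1*p2*p2*p2 + (-18)*p1*p2*p4 + (-12)*p1*p3*p3 + (-6)*p2*p2*p3 + 12*p3*p4, 0, 0, 0)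
        , ((-30)*p1*p1*p1*p1*p2 + 48*p1*p1*p1*p3 + 72*p1*p1*p2*p2 + (-36)*p1*p1*p4 + (-96)*p1*p2*p3 + (-18)*p2*p2*p2 + 36*p2*p4 + 24*p3*p3, 0, 0, 1)
        , (144*p1*p1*p1*p2 + (-156)*p1*p1*p3 + (-162)*p1*p2*p2 + 72*p1*p4 + 108*p2*p3 + (-6)*p1*p1*p1*p1*p1, 0, 0, 2)
        , (60*p1*p1*p1*p1 + (-396)*p1*p1*p2 + 264*p1*p3 + 144*p2*p2 + (-72)*p4, 0, 0, 3)
        , ((-252)*p1*p1*p1 + 612*p1*p2 + (-216)*p3, 0, 0, 4), (576*p1*p1 + (-432)*p2, 0, 0, 5)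
        , ((-720)*p1, 0, 0, 6), (432, 0, 0, 7)
        , ((-30)*p1*p1*p1*p1*p2 + 48*p1*p1*p1*p3 + 72*p1*p1*p2*p2 + (-36)*p1*p1*p4 + (-96)*p1*p2*p3 + (-18)*p2*p2*p2 + 36*p2*p4 + 24*p3*p3, 0, 1, 0)
        , (264*p1*p1*p1*p2 + (-324)*p1*p1*p3 + (-324)*p1*p2*p2 + 180*p1*p4 + 204*p2*p3, 0, 1, 1)
        , ((-1008)*p1*p1*p2 + 744*p1*p3 + 378*p2*p2 + (-180)*p4 + 66*p1*p1*p1*p1, 0, 1, 2)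
        , ((-564)*p1*p1*p1 + 1908*p1*p2 + (-624)*p3, 0, 1, 3), (1836*p1*p1 + (-1476)*p2, 0, 1, 4)
        , ((-2880)*p1, 0, 1, 5), (1800, 0, 1, 6)
        , (144*p1*p1*p1*p2 + (-156)*p1*p1*p3 + (-162)*p1*p2*p2 + 72*p1*p4 + 108*p2*p3 + (-6)*p1*p1*p1*p1*p1, 0, 2, 0)
        , ((-1008)*p1*p1*p2 + 744*p1*p3 + 378*p2*p2 + (-180)*p4 + 66*p1*p1*p1*p1, 0, 2, 1)
        , (2592*p1*p2 + (-840)*p3 + (-564)*p1*p1*p1, 0, 2, 2), (2520*p1*p1 + (-2376)*p2, 0, 2, 3)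
        , ((-4932)*p1, 0, 2, 4), (3600, 0, 2, 5)
        , (60*p1*p1*p1*p1 + (-396)*p1*p1*p2 + 264*p1*p3 + 144*p2*p2 + (-72)*p4, 0, 3, 0)
        , ((-564)*p1*p1*p1 + 1908*p1*p2 + (-624)*p3, 0, 3, 1), (2520*p1*p1 + (-2376)*p2, 0, 3, 2)
        , ((-5616)*p1, 0, 3, 3), (4752, 0, 3, 4), ((-252)*p1*p1*p1 + 612*p1*p2 + (-216)*p3, 0, 4, 0)
        , (1836*p1*p1 + (-1476)*p2, 0, 4, 1), ((-4932)*p1, 0, 4, 2), (4752, 0, 4, 3)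
        , (576*p1*p1 + (-432)*p2, 0, 5, 0), ((-2880)*p1, 0, 5, 1), (3600, 0, 5, 2), ((-720)*p1, 0, 6, 0)
        , (1800, 0, 6, 1), (432, 0, 7, 0)
        , ((-30)*p1*p1*p1*p1*p2 + 48*p1*p1*p1*p3 + 72*p1*p1*p2*p2 + (-36)*p1*p1*p4 + (-96)*p1*p2*p3 + (-18)*p2*p2*p2 + 36*p2*p4 + 24*p3*p3, 1, 0, 0)
        , (264*p1*p1*p1*p2 + (-324)*p1*p1*p3 + (-324)*p1*p2*p2 + 180*p1*p4 + 204*p2*p3, 1, 0, 1)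
        , ((-1008)*p1*p1*p2 + 744*p1*p3 + 378*p2*p2 + (-180)*p4 + 66*p1*p1*p1*p1, 1, 0, 2)
        , ((-564)*p1*p1*p1 + 1908*p1*p2 + (-624)*p3, 1, 0, 3), (1836*p1*p1 + (-1476)*p2, 1, 0, 4)
        , ((-2880)*p1, 1, 0, 5), (1800, 1, 0, 6)
        , (264*p1*p1*p1*p2 + (-324)*p1*p1*p3 + (-324)*p1*p2*p2 + 180*p1*p4 + 204*p2*p3, 1, 1, 0)
        , ((-1980)*p1*p1*p2 + 1800*p1*p3 + 900*p2*p2 + (-720)*p4, 1, 1, 1)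
        , (5580*p1*p2 + (-2400)*p3 + (-660)*p1*p1*p1, 1, 1, 2), (4680*p1*p1 + (-5760)*p2, 1, 1, 3)
        , ((-10800)*p1, 1, 1, 4), (9360, 1, 1, 5)
        , ((-1008)*p1*p1*p2 + 744*p1*p3 + 378*p2*p2 + (-180)*p4 + 66*p1*p1*p1*p1, 1, 2, 0)
        , (5580*p1*p2 + (-2400)*p3 + (-660)*p1*p1*p1, 1, 2, 1), ((-8280)*p2 + 4680*p1*p1, 1, 2, 2)
        , ((-15840)*p1, 1, 2, 3), (16920, 1, 2, 4), ((-564)*p1*p1*p1 + 1908*p1*p2 + (-624)*p3, 1, 3, 0)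
        , (4680*p1*p1 + (-5760)*p2, 1, 3, 1), ((-15840)*p1, 1, 3, 2), (19440, 1, 3, 3)
        , (1836*p1*p1 + (-1476)*p2, 1, 4, 0), ((-10800)*p1, 1, 4, 1), (16920, 1, 4, 2)
        , ((-2880)*p1, 1, 5, 0), (9360, 1, 5, 1), (1800, 1, 6, 0)
        , (144*p1*p1*p1*p2 + (-156)*p1*p1*p3 + (-162)*p1*p2*p2 + 72*p1*p4 + 108*p2*p3 + (-6)*p1*p1*p1*p1*p1, 2, 0, 0)
        , ((-1008)*p1*p1*p2 + 744*p1*p3 + 378*p2*p2 + (-180)*p4 + 66*p1*p1*p1*p1, 2, 0, 1)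
        , (2592*p1*p2 + (-840)*p3 + (-564)*p1*p1*p1, 2, 0, 2), (2520*p1*p1 + (-2376)*p2, 2, 0, 3)
        , ((-4932)*p1, 2, 0, 4), (3600, 2, 0, 5)
        , ((-1008)*p1*p1*p2 + 744*p1*p3 + 378*p2*p2 + (-180)*p4 + 66*p1*p1*p1*p1, 2, 1, 0)
        , (5580*p1*p2 + (-2400)*p3 + (-660)*p1*p1*p1, 2, 1, 1), ((-8280)*p2 + 4680*p1*p1, 2, 1, 2)
        , ((-15840)*p1, 2, 1, 3), (16920, 2, 1, 4), (2592*p1*p2 + (-840)*p3 + (-564)*p1*p1*p1, 2, 2, 0)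
        , ((-8280)*p2 + 4680*p1*p1, 2, 2, 1), ((-18360)*p1, 2, 2, 2), (29520, 2, 2, 3)
        , (2520*p1*p1 + (-2376)*p2, 2, 3, 0), ((-15840)*p1, 2, 3, 1), (29520, 2, 3, 2)
        , ((-4932)*p1, 2, 4, 0), (16920, 2, 4, 1), (3600, 2, 5, 0)
        , (60*p1*p1*p1*p1 + (-396)*p1*p1*p2 + 264*p1*p3 + 144*p2*p2 + (-72)*p4, 3, 0, 0)
        , ((-564)*p1*p1*p1 + 1908*p1*p2 + (-624)*p3, 3, 0, 1), (2520*p1*p1 + (-2376)*p2, 3, 0, 2)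
        , ((-5616)*p1, 3, 0, 3), (4752, 3, 0, 4), ((-564)*p1*p1*p1 + 1908*p1*p2 + (-624)*p3, 3, 1, 0)
        , (4680*p1*p1 + (-5760)*p2, 3, 1, 1), ((-15840)*p1, 3, 1, 2), (19440, 3, 1, 3)
        , (2520*p1*p1 + (-2376)*p2, 3, 2, 0), ((-15840)*p1, 3, 2, 1), (29520, 3, 2, 2)
        , ((-5616)*p1, 3, 3, 0), (19440, 3, 3, 1), (4752, 3, 4, 0)
        , ((-252)*p1*p1*p1 + 612*p1*p2 + (-216)*p3, 4, 0, 0), (1836*p1*p1 + (-1476)*p2, 4, 0, 1)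
        , ((-4932)*p1, 4, 0, 2), (4752, 4, 0, 3), (1836*p1*p1 + (-1476)*p2, 4, 1, 0)
        , ((-10800)*p1, 4, 1, 1), (16920, 4, 1, 2), ((-4932)*p1, 4, 2, 0), (16920, 4, 2, 1)
        , (4752, 4, 3, 0), (576*p1*p1 + (-432)*p2, 5, 0, 0), ((-2880)*p1, 5, 0, 1), (3600, 5, 0, 2)
        , ((-2880)*p1, 5, 1, 0), (9360, 5, 1, 1), (3600, 5, 2, 0), ((-720)*p1, 6, 0, 0), (1800, 6, 0, 1)
        , (1800, 6, 1, 0), (432, 7, 0, 0)] a b c := by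
    intro a b c; simp only [ev1, ev2, ev3, List.map_cons, List.map_nil, List.sum_cons, List.sum_nil,
      w111, w211]; ring
  have h2 : ∀ a b : ℝ, w111 p1 p2 p3 a a b * w211 p1 p2 p3 p4 a a b =
        ev2 [(3*p1*p1*p1*p1*p1*p2 + (-6)*p1*p1*p1*p1*p3 + (-12)*p1*p1*p1*p2*p2 + 6*p1*p1*p1*p4 + 24*p1*p1*p2*p3 + 9*p1*p2*p2*p2 + (-18)*p1*p2*p4 + (-12)*p1*p3*p3 + (-6)*p2*p2*p3 + 12*p3*p4, 0, 0)
        , ((-30)*p1*p1*p1*p1*p2 + 48*p1*p1*p1*p3 + 72*p1*p1*p2*p2 + (-36)*p1*p1*p4 + (-96)*p1*p2*p3 + (-18)*p2*p2*p2 + 36*p2*p4 + 24*p3*p3, 0, 1)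
        , (144*p1*p1*p1*p2 + (-156)*p1*p1*p3 + (-162)*p1*p2*p2 + 72*p1*p4 + 108*p2*p3 + (-6)*p1*p1*p1*p1*p1, 0, 2)
        , (60*p1*p1*p1*p1 + (-396)*p1*p1*p2 + 264*p1*p3 + 144*p2*p2 + (-72)*p4, 0, 3)
        , ((-252)*p1*p1*p1 + 612*p1*p2 + (-216)*p3, 0, 4), (576*p1*p1 + (-432)*p2, 0, 5)
        , ((-720)*p1, 0, 6), (432, 0, 7)
        , ((-60)*p1*p1*p1*p1*p2 + 96*p1*p1*p1*p3 + 144*p1*p1*p2*p2 + (-72)*p1*p1*p4 + (-192)*p1*p2*p3 + (-36)*p2*p2*p2 + 72*p2*p4 + 48*p3*p3, 1, 0)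
        , (528*p1*p1*p1*p2 + (-648)*p1*p1*p3 + (-648)*p1*p2*p2 + 360*p1*p4 + 408*p2*p3, 1, 1)
        , ((-2016)*p1*p1*p2 + 1488*p1*p3 + 756*p2*p2 + (-360)*p4 + 132*p1*p1*p1*p1, 1, 2)
        , ((-1128)*p1*p1*p1 + 3816*p1*p2 + (-1248)*p3, 1, 3), (3672*p1*p1 + (-2952)*p2, 1, 4)
        , ((-5760)*p1, 1, 5), (3600, 1, 6)
        , (552*p1*p1*p1*p2 + (-636)*p1*p1*p3 + (-648)*p1*p2*p2 + 324*p1*p4 + 420*p2*p3 + (-12)*p1*p1*p1*p1*p1, 2, 0)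
        , ((-3996)*p1*p1*p2 + 3288*p1*p3 + 1656*p2*p2 + (-1080)*p4 + 132*p1*p1*p1*p1, 2, 1)
        , (10764*p1*p2 + (-4080)*p3 + (-1788)*p1*p1*p1, 2, 2), (9720*p1*p1 + (-10512)*p2, 2, 3)
        , ((-20664)*p1, 2, 4), (16560, 2, 5)
        , ((-2808)*p1*p1*p2 + 2016*p1*p3 + 1044*p2*p2 + (-504)*p4 + 252*p1*p1*p1*p1, 3, 0)
        , (14976*p1*p2 + (-6048)*p3 + (-2448)*p1*p1*p1, 3, 1), ((-21312)*p2 + 14400*p1*p1, 3, 2)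
        , ((-42912)*p1, 3, 3), (43344, 3, 4), (7632*p1*p2 + (-2196)*p1*p1*p1 + (-2520)*p3, 4, 0)
        , ((-22752)*p2 + 17712*p1*p1, 4, 1), ((-59904)*p1, 4, 2), (77904, 4, 3)
        , (9864*p1*p1 + (-8568)*p2, 5, 0), ((-59040)*p1, 5, 1), (100080, 5, 2), ((-22680)*p1, 6, 0)
        , (75600, 6, 1), (21168, 7, 0)] a b := by
    intro a b; simp only [ev1, ev2, ev3, List.map_cons, List.map_nil, List.sum_cons, List.sum_nil,
      w111, w211]; ring
  have h3 : ∀ a : ℝ, w111 p1 p2 p3 a a a * w211 p1 p2 p3 p4 a a a =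
        ev1 [(3*p1*p1*p1*p1*p1*p2 + (-6)*p1*p1*p1*p1*p3 + (-12)*p1*p1*p1*p2*p2 + 6*p1*p1*p1*p4 + 24*p1*p1*p2*p3 + 9*p1*p2*p2*p2 + (-18)*p1*p2*p4 + (-12)*p1*p3*p3 + (-6)*p2*p2*p3 + 12*p3*p4, 0)
        , ((-90)*p1*p1*p1*p1*p2 + 144*p1*p1*p1*p3 + 216*p1*p1*p2*p2 + (-108)*p1*p1*p4 + (-288)*p1*p2*p3 + (-54)*p2*p2*p2 + 108*p2*p4 + 72*p3*p3, 1)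
        , (1224*p1*p1*p1*p2 + (-1440)*p1*p1*p3 + (-1458)*p1*p2*p2 + 756*p1*p4 + 936*p2*p3 + (-18)*p1*p1*p1*p1*p1, 2)
        , ((-9216)*p1*p1*p2 + 7056*p1*p3 + 3600*p2*p2 + (-2016)*p4 + 576*p1*p1*p1*p1, 3)
        , (37800*p1*p2 + (-14112)*p3 + (-7812)*p1*p1*p1, 4), ((-66528)*p2 + 55944*p1*p1, 5)
        , ((-211680)*p1, 6), (338688, 7)] a := by
    intro a; simp only [ev1, ev2, ev3, List.map_cons, List.map_nil, List.sum_cons, List.sum_nil,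
      w111, w211]; ring
  rw [S3_eq]
  · simp only [h3]
    simp only [h2]
    simp only [h1]
    simp only [sum_ev1, sum_ev2, sum_ev3, List.map_cons, List.map_nil, List.sum_cons,
      List.sum_nil]
    rw [ps_zero]
    simp only [e1, e2, e3, e4, e5, e6, e7, e8]
    ring
  · intro a b; simp only [w111, w211]; ring
  · intro a b; simp only [w111, w211]; ring

set_option maxRecDepth 10000 in
set_option maxHeartbeats 4000000 in
lemma k53_vv (x : Fin 8 → ℝ) (p1 p2 p3 p4 p5 p6 p7 p8 : ℝ)
    (e1 : ps x 1 = p1) (e2 : ps x 2 = p2) (e3 : ps x 3 = p3) (e4 : ps x 4 = p4) (e5 : ps x 5 = p5) (e6 : ps x 6 = p6) (e7 : ps x 7 = p7) (e8 : ps x 8 = p8) :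
    S3 x (fun a b c => w211 p1 p2 p3 p4 a b c * w211 p1 p2 p3 p4 a b c) =
    164160*p2*p2*p4 + 164160*p2*p3*p3 + (-73440)*p1*p1*p2*p4 + (-34560)*p1*p1*p3*p3
    + (-90720)*p1*p2*p2*p3 + 233280*p1*p2*p5 + 216000*p1*p3*p4 + (-11880)*p2*p2*p2*p2
    + 2160*p1*p1*p1*p1*p4 + 12960*p1*p1*p1*p2*p3 + (-17280)*p1*p1*p1*p5 + 103680*p1*p1*p6
    + 10800*p1*p1*p2*p2*p2 + (-1080)*p1*p1*p1*p1*p2*p2 + (-466560)*p2*p6 + (-397440)*p3*p5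
    + (-177120)*p4*p4 + (-362880)*p1*p7 + 725760*p8 := by
  have h1 : ∀ a b c : ℝ, w211 p1 p2 p3 p4 a b c * w211 p1 p2 p3 p4 a b c =
        ev3 [(9*p1*p1*p1*p1*p2*p2 + (-36)*p1*p1*p1*p2*p3 + (-18)*p1*p1*p2*p2*p2 + 36*p1*p1*p2*p4 + 36*p1*p1*p3*p3 + 36*p1*p2*p2*p3 + (-72)*p1*p3*p4 + 9*p2*p2*p2*p2 + (-36)*p2*p2*p4 + 36*p4*p4, 0, 0, 0)
        , ((-72)*p1*p1*p1*p2*p2 + 216*p1*p1*p2*p3 + 72*p1*p2*p2*p2 + (-144)*p1*p2*p4 + (-144)*p1*p3*p3 + (-72)*p2*p2*p3 + 144*p3*p4, 0, 0, 1)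
        , ((-36)*p1*p1*p1*p1*p2 + 72*p1*p1*p1*p3 + 288*p1*p1*p2*p2 + (-72)*p1*p1*p4 + (-504)*p1*p2*p3 + (-108)*p2*p2*p2 + 216*p2*p4 + 144*p3*p3, 0, 0, 2)
        , (288*p1*p1*p1*p2 + (-432)*p1*p1*p3 + (-576)*p1*p2*p2 + 288*p1*p4 + 432*p2*p3, 0, 0, 3)
        , (36*p1*p1*p1*p1 + (-1008)*p1*p1*p2 + 1008*p1*p3 + 540*p2*p2 + (-432)*p4, 0, 0, 4)
        , ((-288)*p1*p1*p1 + 1728*p1*p2 + (-864)*p3, 0, 0, 5), (1008*p1*p1 + (-1296)*p2, 0, 0, 6)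
        , ((-1728)*p1, 0, 0, 7), (1296, 0, 0, 8)
        , ((-72)*p1*p1*p1*p2*p2 + 216*p1*p1*p2*p3 + 72*p1*p2*p2*p2 + (-144)*p1*p2*p4 + (-144)*p1*p3*p3 + (-72)*p2*p2*p3 + 144*p3*p4, 0, 1, 0)
        , (468*p1*p1*p2*p2 + (-936)*p1*p2*p3 + (-180)*p2*p2*p2 + 360*p2*p4 + 288*p3*p3, 0, 1, 1)
        , (324*p1*p1*p1*p2 + (-504)*p1*p1*p3 + (-1332)*p1*p2*p2 + 360*p1*p4 + 1152*p2*p3, 0, 1, 2)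
        , ((-2016)*p1*p1*p2 + 2016*p1*p3 + 1440*p2*p2 + (-720)*p4, 0, 1, 3)
        , ((-360)*p1*p1*p1 + 4824*p1*p2 + (-2304)*p3, 0, 1, 4), (2160*p1*p1 + (-4320)*p2, 0, 1, 5)
        , ((-5040)*p1, 0, 1, 6), (4320, 0, 1, 7)
        , ((-36)*p1*p1*p1*p1*p2 + 72*p1*p1*p1*p3 + 288*p1*p1*p2*p2 + (-72)*p1*p1*p4 + (-504)*p1*p2*p3 + (-108)*p2*p2*p2 + 216*p2*p4 + 144*p3*p3, 0, 2, 0)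
        , (324*p1*p1*p1*p2 + (-504)*p1*p1*p3 + (-1332)*p1*p2*p2 + 360*p1*p4 + 1152*p2*p3, 0, 2, 1)
        , ((-2232)*p1*p1*p2 + 2160*p1*p3 + 1908*p2*p2 + (-720)*p4 + 72*p1*p1*p1*p1, 0, 2, 2)
        , ((-648)*p1*p1*p1 + 6624*p1*p2 + (-2880)*p3, 0, 2, 3), (3492*p1*p1 + (-7056)*p2, 0, 2, 4)
        , ((-8640)*p1, 0, 2, 5), (7920, 0, 2, 6)
        , (288*p1*p1*p1*p2 + (-432)*p1*p1*p3 + (-576)*p1*p2*p2 + 288*p1*p4 + 432*p2*p3, 0, 3, 0)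
        , ((-2016)*p1*p1*p2 + 2016*p1*p3 + 1440*p2*p2 + (-720)*p4, 0, 3, 1)
        , (6624*p1*p2 + (-648)*p1*p1*p1 + (-2880)*p3, 0, 3, 2), (4392*p1*p1 + (-7920)*p2, 0, 3, 3)
        , ((-11808)*p1, 0, 3, 4), (11520, 0, 3, 5)
        , (36*p1*p1*p1*p1 + (-1008)*p1*p1*p2 + 1008*p1*p3 + 540*p2*p2 + (-432)*p4, 0, 4, 0)
        , ((-360)*p1*p1*p1 + 4824*p1*p2 + (-2304)*p3, 0, 4, 1), (3492*p1*p1 + (-7056)*p2, 0, 4, 2)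
        , ((-11808)*p1, 0, 4, 3), (13392, 0, 4, 4), ((-288)*p1*p1*p1 + 1728*p1*p2 + (-864)*p3, 0, 5, 0)
        , (2160*p1*p1 + (-4320)*p2, 0, 5, 1), ((-8640)*p1, 0, 5, 2), (11520, 0, 5, 3)
        , (1008*p1*p1 + (-1296)*p2, 0, 6, 0), ((-5040)*p1, 0, 6, 1), (7920, 0, 6, 2)
        , ((-1728)*p1, 0, 7, 0), (4320, 0, 7, 1), (1296, 0, 8, 0)
        , ((-72)*p1*p1*p1*p2*p2 + 216*p1*p1*p2*p3 + 72*p1*p2*p2*p2 + (-144)*p1*p2*p4 + (-144)*p1*p3*p3 + (-72)*p2*p2*p3 + 144*p3*p4, 1, 0, 0)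
        , (468*p1*p1*p2*p2 + (-936)*p1*p2*p3 + (-180)*p2*p2*p2 + 360*p2*p4 + 288*p3*p3, 1, 0, 1)
        , (324*p1*p1*p1*p2 + (-504)*p1*p1*p3 + (-1332)*p1*p2*p2 + 360*p1*p4 + 1152*p2*p3, 1, 0, 2)
        , ((-2016)*p1*p1*p2 + 2016*p1*p3 + 1440*p2*p2 + (-720)*p4, 1, 0, 3)
        , ((-360)*p1*p1*p1 + 4824*p1*p2 + (-2304)*p3, 1, 0, 4), (2160*p1*p1 + (-4320)*p2, 1, 0, 5)
        , ((-5040)*p1, 1, 0, 6), (4320, 1, 0, 7)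
        , (468*p1*p1*p2*p2 + (-936)*p1*p2*p3 + (-180)*p2*p2*p2 + 360*p2*p4 + 288*p3*p3, 1, 1, 0)
        , ((-2160)*p1*p2*p2 + 2160*p2*p3, 1, 1, 1)
        , ((-2520)*p1*p1*p2 + 2880*p1*p3 + 3600*p2*p2 + (-1440)*p4, 1, 1, 2)
        , (10800*p1*p2 + (-5760)*p3, 1, 1, 3), (3240*p1*p1 + (-13680)*p2, 1, 1, 4)
        , ((-12960)*p1, 1, 1, 5), (15840, 1, 1, 6)
        , (324*p1*p1*p1*p2 + (-504)*p1*p1*p3 + (-1332)*p1*p2*p2 + 360*p1*p4 + 1152*p2*p3, 1, 2, 0)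
        , ((-2520)*p1*p1*p2 + 2880*p1*p3 + 3600*p2*p2 + (-1440)*p4, 1, 2, 1)
        , (12960*p1*p2 + (-7200)*p3 + (-720)*p1*p1*p1, 1, 2, 2), (5400*p1*p1 + (-20880)*p2, 1, 2, 3)
        , ((-22320)*p1, 1, 2, 4), (30240, 1, 2, 5)
        , ((-2016)*p1*p1*p2 + 2016*p1*p3 + 1440*p2*p2 + (-720)*p4, 1, 3, 0)
        , (10800*p1*p2 + (-5760)*p3, 1, 3, 1), ((-20880)*p2 + 5400*p1*p1, 1, 3, 2)
        , ((-27360)*p1, 1, 3, 3), (40320, 1, 3, 4), ((-360)*p1*p1*p1 + 4824*p1*p2 + (-2304)*p3, 1, 4, 0)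
        , (3240*p1*p1 + (-13680)*p2, 1, 4, 1), ((-22320)*p1, 1, 4, 2), (40320, 1, 4, 3)
        , (2160*p1*p1 + (-4320)*p2, 1, 5, 0), ((-12960)*p1, 1, 5, 1), (30240, 1, 5, 2)
        , ((-5040)*p1, 1, 6, 0), (15840, 1, 6, 1), (4320, 1, 7, 0)
        , ((-36)*p1*p1*p1*p1*p2 + 72*p1*p1*p1*p3 + 288*p1*p1*p2*p2 + (-72)*p1*p1*p4 + (-504)*p1*p2*p3 + (-108)*p2*p2*p2 + 216*p2*p4 + 144*p3*p3, 2, 0, 0)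
        , (324*p1*p1*p1*p2 + (-504)*p1*p1*p3 + (-1332)*p1*p2*p2 + 360*p1*p4 + 1152*p2*p3, 2, 0, 1)
        , ((-2232)*p1*p1*p2 + 2160*p1*p3 + 1908*p2*p2 + (-720)*p4 + 72*p1*p1*p1*p1, 2, 0, 2)
        , ((-648)*p1*p1*p1 + 6624*p1*p2 + (-2880)*p3, 2, 0, 3), (3492*p1*p1 + (-7056)*p2, 2, 0, 4)
        , ((-8640)*p1, 2, 0, 5), (7920, 2, 0, 6)
        , (324*p1*p1*p1*p2 + (-504)*p1*p1*p3 + (-1332)*p1*p2*p2 + 360*p1*p4 + 1152*p2*p3, 2, 1, 0)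
        , ((-2520)*p1*p1*p2 + 2880*p1*p3 + 3600*p2*p2 + (-1440)*p4, 2, 1, 1)
        , (12960*p1*p2 + (-7200)*p3 + (-720)*p1*p1*p1, 2, 1, 2), (5400*p1*p1 + (-20880)*p2, 2, 1, 3)
        , ((-22320)*p1, 2, 1, 4), (30240, 2, 1, 5)
        , ((-2232)*p1*p1*p2 + 2160*p1*p3 + 1908*p2*p2 + (-720)*p4 + 72*p1*p1*p1*p1, 2, 2, 0)
        , (12960*p1*p2 + (-7200)*p3 + (-720)*p1*p1*p1, 2, 2, 1), ((-28080)*p2 + 7560*p1*p1, 2, 2, 2)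
        , ((-31680)*p1, 2, 2, 3), (54720, 2, 2, 4), ((-648)*p1*p1*p1 + 6624*p1*p2 + (-2880)*p3, 2, 3, 0)
        , (5400*p1*p1 + (-20880)*p2, 2, 3, 1), ((-31680)*p1, 2, 3, 2), (64800, 2, 3, 3)
        , (3492*p1*p1 + (-7056)*p2, 2, 4, 0), ((-22320)*p1, 2, 4, 1), (54720, 2, 4, 2)
        , ((-8640)*p1, 2, 5, 0), (30240, 2, 5, 1), (7920, 2, 6, 0)
        , (288*p1*p1*p1*p2 + (-432)*p1*p1*p3 + (-576)*p1*p2*p2 + 288*p1*p4 + 432*p2*p3, 3, 0, 0)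
        , ((-2016)*p1*p1*p2 + 2016*p1*p3 + 1440*p2*p2 + (-720)*p4, 3, 0, 1)
        , (6624*p1*p2 + (-648)*p1*p1*p1 + (-2880)*p3, 3, 0, 2), (4392*p1*p1 + (-7920)*p2, 3, 0, 3)
        , ((-11808)*p1, 3, 0, 4), (11520, 3, 0, 5)
        , ((-2016)*p1*p1*p2 + 2016*p1*p3 + 1440*p2*p2 + (-720)*p4, 3, 1, 0)
        , (10800*p1*p2 + (-5760)*p3, 3, 1, 1), ((-20880)*p2 + 5400*p1*p1, 3, 1, 2)
        , ((-27360)*p1, 3, 1, 3), (40320, 3, 1, 4), (6624*p1*p2 + (-648)*p1*p1*p1 + (-2880)*p3, 3, 2, 0)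
        , ((-20880)*p2 + 5400*p1*p1, 3, 2, 1), ((-31680)*p1, 3, 2, 2), (64800, 3, 2, 3)
        , (4392*p1*p1 + (-7920)*p2, 3, 3, 0), ((-27360)*p1, 3, 3, 1), (64800, 3, 3, 2)
        , ((-11808)*p1, 3, 4, 0), (40320, 3, 4, 1), (11520, 3, 5, 0)
        , (36*p1*p1*p1*p1 + (-1008)*p1*p1*p2 + 1008*p1*p3 + 540*p2*p2 + (-432)*p4, 4, 0, 0)
        , ((-360)*p1*p1*p1 + 4824*p1*p2 + (-2304)*p3, 4, 0, 1), (3492*p1*p1 + (-7056)*p2, 4, 0, 2)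
        , ((-11808)*p1, 4, 0, 3), (13392, 4, 0, 4), ((-360)*p1*p1*p1 + 4824*p1*p2 + (-2304)*p3, 4, 1, 0)
        , (3240*p1*p1 + (-13680)*p2, 4, 1, 1), ((-22320)*p1, 4, 1, 2), (40320, 4, 1, 3)
        , (3492*p1*p1 + (-7056)*p2, 4, 2, 0), ((-22320)*p1, 4, 2, 1), (54720, 4, 2, 2)
        , ((-11808)*p1, 4, 3, 0), (40320, 4, 3, 1), (13392, 4, 4, 0)
        , ((-288)*p1*p1*p1 + 1728*p1*p2 + (-864)*p3, 5, 0, 0), (2160*p1*p1 + (-4320)*p2, 5, 0, 1)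
        , ((-8640)*p1, 5, 0, 2), (11520, 5, 0, 3), (2160*p1*p1 + (-4320)*p2, 5, 1, 0)
        , ((-12960)*p1, 5, 1, 1), (30240, 5, 1, 2), ((-8640)*p1, 5, 2, 0), (30240, 5, 2, 1)
        , (11520, 5, 3, 0), (1008*p1*p1 + (-1296)*p2, 6, 0, 0), ((-5040)*p1, 6, 0, 1), (7920, 6, 0, 2)
        , ((-5040)*p1, 6, 1, 0), (15840, 6, 1, 1), (7920, 6, 2, 0), ((-1728)*p1, 7, 0, 0)
        , (4320, 7, 0, 1), (4320, 7, 1, 0), (1296, 8, 0, 0)] a b c := by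
    intro a b c; simp only [ev1, ev2, ev3, List.map_cons, List.map_nil, List.sum_cons, List.sum_nil,
      w211]; ring
  have h2 : ∀ a b : ℝ, w211 p1 p2 p3 p4 a a b * w211 p1 p2 p3 p4 a a b =
        ev2 [(9*p1*p1*p1*p1*p2*p2 + (-36)*p1*p1*p1*p2*p3 + (-18)*p1*p1*p2*p2*p2 + 36*p1*p1*p2*p4 + 36*p1*p1*p3*p3 + 36*p1*p2*p2*p3 + (-72)*p1*p3*p4 + 9*p2*p2*p2*p2 + (-36)*p2*p2*p4 + 36*p4*p4, 0, 0)
        , ((-72)*p1*p1*p1*p2*p2 + 216*p1*p1*p2*p3 + 72*p1*p2*p2*p2 + (-144)*p1*p2*p4 + (-144)*p1*p3*p3 + (-72)*p2*p2*p3 + 144*p3*p4, 0, 1)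
        , ((-36)*p1*p1*p1*p1*p2 + 72*p1*p1*p1*p3 + 288*p1*p1*p2*p2 + (-72)*p1*p1*p4 + (-504)*p1*p2*p3 + (-108)*p2*p2*p2 + 216*p2*p4 + 144*p3*p3, 0, 2)
        , (288*p1*p1*p1*p2 + (-432)*p1*p1*p3 + (-576)*p1*p2*p2 + 288*p1*p4 + 432*p2*p3, 0, 3)
        , (36*p1*p1*p1*p1 + (-1008)*p1*p1*p2 + 1008*p1*p3 + 540*p2*p2 + (-432)*p4, 0, 4)
        , ((-288)*p1*p1*p1 + 1728*p1*p2 + (-864)*p3, 0, 5), (1008*p1*p1 + (-1296)*p2, 0, 6)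
        , ((-1728)*p1, 0, 7), (1296, 0, 8)
        , ((-144)*p1*p1*p1*p2*p2 + 432*p1*p1*p2*p3 + 144*p1*p2*p2*p2 + (-288)*p1*p2*p4 + (-288)*p1*p3*p3 + (-144)*p2*p2*p3 + 288*p3*p4, 1, 0)
        , (936*p1*p1*p2*p2 + (-1872)*p1*p2*p3 + (-360)*p2*p2*p2 + 720*p2*p4 + 576*p3*p3, 1, 1)
        , (648*p1*p1*p1*p2 + (-1008)*p1*p1*p3 + (-2664)*p1*p2*p2 + 720*p1*p4 + 2304*p2*p3, 1, 2)
        , ((-4032)*p1*p1*p2 + 4032*p1*p3 + 2880*p2*p2 + (-1440)*p4, 1, 3)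
        , ((-720)*p1*p1*p1 + 9648*p1*p2 + (-4608)*p3, 1, 4), (4320*p1*p1 + (-8640)*p2, 1, 5)
        , ((-10080)*p1, 1, 6), (8640, 1, 7)
        , (1044*p1*p1*p2*p2 + (-1944)*p1*p2*p3 + (-396)*p2*p2*p2 + 792*p2*p4 + (-72)*p1*p1*p1*p1*p2 + 144*p1*p1*p1*p3 + (-144)*p1*p1*p4 + 576*p3*p3, 2, 0)
        , ((-4824)*p1*p2*p2 + 4464*p2*p3 + 648*p1*p1*p1*p2 + (-1008)*p1*p1*p3 + 720*p1*p4, 2, 1)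
        , ((-6984)*p1*p1*p2 + 7200*p1*p3 + 7416*p2*p2 + (-2880)*p4 + 144*p1*p1*p1*p1, 2, 2)
        , (24048*p1*p2 + (-11520)*p3 + (-1296)*p1*p1*p1, 2, 3), (10224*p1*p1 + (-27792)*p2, 2, 4)
        , ((-30240)*p1, 2, 5), (31680, 2, 6)
        , (1224*p1*p1*p1*p2 + (-1872)*p1*p1*p3 + (-3816)*p1*p2*p2 + 1296*p1*p4 + 3168*p2*p3, 3, 0)
        , ((-9072)*p1*p1*p2 + 9792*p1*p3 + 10080*p2*p2 + (-4320)*p4, 3, 1)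
        , (39168*p1*p2 + (-20160)*p3 + (-2736)*p1*p1*p1, 3, 2), (19584*p1*p1 + (-57600)*p2, 3, 3)
        , ((-68256)*p1, 3, 4), (83520, 3, 5)
        , ((-8280)*p1*p1*p2 + 8208*p1*p3 + 5868*p2*p2 + (-3024)*p4 + 144*p1*p1*p1*p1, 4, 0)
        , (44208*p1*p2 + (-23328)*p3 + (-1440)*p1*p1*p1, 4, 1), ((-83952)*p2 + 25344*p1*p1, 4, 2)
        , ((-110016)*p1, 4, 3), (162144, 4, 4), (26352*p1*p2 + (-2592)*p1*p1*p1 + (-12096)*p3, 5, 0)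
        , ((-77760)*p2 + 21600*p1*p1, 5, 1), ((-125280)*p1, 5, 2), (233280, 5, 3)
        , (17712*p1*p1 + (-33264)*p2, 6, 0), ((-108000)*p1, 6, 1), (250560, 6, 2), ((-54432)*p1, 7, 0)
        , (181440, 7, 1), (63504, 8, 0)] a b := by
    intro a b; simp only [ev1, ev2, ev3, List.map_cons, List.map_nil, List.sum_cons, List.sum_nil,
      w211]; ring
  have h3 : ∀ a : ℝ, w211 p1 p2 p3 p4 a a a * w211 p1 p2 p3 p4 a a a =
        ev1 [(9*p1*p1*p1*p1*p2*p2 + (-36)*p1*p1*p1*p2*p3 + (-18)*p1*p1*p2*p2*p2 + 36*p1*p1*p2*p4 + 36*p1*p1*p3*p3 + 36*p1*p2*p2*p3 + (-72)*p1*p3*p4 + 9*p2*p2*p2*p2 + (-36)*p2*p2*p4 + 36*p4*p4, 0)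
        , ((-216)*p1*p1*p1*p2*p2 + 648*p1*p1*p2*p3 + 216*p1*p2*p2*p2 + (-432)*p1*p2*p4 + (-432)*p1*p3*p3 + (-216)*p2*p2*p3 + 432*p3*p4, 1)
        , (2268*p1*p1*p2*p2 + (-4320)*p1*p2*p3 + (-864)*p2*p2*p2 + 1728*p2*p4 + (-108)*p1*p1*p1*p1*p2 + 216*p1*p1*p1*p3 + (-216)*p1*p1*p4 + 1296*p3*p3, 2)
        , (2808*p1*p1*p1*p2 + (-4320)*p1*p1*p3 + (-11880)*p1*p2*p2 + 3024*p1*p4 + 10368*p2*p3, 3)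
        , ((-29376)*p1*p1*p2 + 30240*p1*p3 + 26784*p2*p2 + (-12096)*p4 + 324*p1*p1*p1*p1, 4)
        , (145152*p1*p2 + (-72576)*p3 + (-9072)*p1*p1*p1, 5), ((-290304)*p2 + 99792*p1*p1, 6)
        , ((-508032)*p1, 7), (1016064, 8)] a := by
    intro a; simp only [ev1, ev2, ev3, List.map_cons, List.map_nil, List.sum_cons, List.sum_nil,
      w211]; ring
  rw [S3_eq]
  · simp only [h3]
    simp only [h2]
    simp only [h1]
    simp only [sum_ev1, sum_ev2, sum_ev3, List.map_cons, List.map_nil, List.sum_cons,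
      List.sum_nil]
    rw [ps_zero]
    simp only [e1, e2, e3, e4, e5, e6, e7, e8]
    ring
  · intro a b; simp only [w211]; ring
  · intro a b; simp only [w211]; ring

set_option maxHeartbeats 4000000 in
lemma final_ring (p1 p2 p3 p4 p5 p6 p7 p8 : ℝ) :
    (1/40320)*p1*p1*p1*p1*p1*p1*p1*p1 + (-1/1440)*p1*p1*p1*p1*p1*p1*p2 + (1/360)*p1*p1*p1*p1*p1*p3
    + (1/192)*p1*p1*p1*p1*p2*p2 + (-1/96)*p1*p1*p1*p1*p4 + (-1/36)*p1*p1*p1*p2*p3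
    + (1/30)*p1*p1*p1*p5 + (-1/96)*p1*p1*p2*p2*p2 + (1/16)*p1*p1*p2*p4 + (1/36)*p1*p1*p3*p3
    + (-1/12)*p1*p1*p6 + (1/24)*p1*p2*p2*p3 + (-1/10)*p1*p2*p5 + (-1/12)*p1*p3*p4 + (1/7)*p1*p7
    + (1/384)*p2*p2*p2*p2 + (-1/32)*p2*p2*p4 + (-1/36)*p2*p3*p3 + (1/12)*p2*p6 + (1/15)*p3*p5
    + (1/32)*p4*p4 + (-1/8)*p8 + 11/1000 =
    ((11/1000) + (-11685021/536870912)*p1 + (268375/33554432)*p2 + (5263861/134217728)*p1*p1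
    + (-36508496317/773094113280)*p3 + (-1272351/134217728)*p1*p2 + (-20312921/536870912)*p1*p1*p1
    + (-2419573/67108864)*p4 + (132154805651/2164663517184)*p1*p3 + (54038605/536870912)*p2*p2
    + (-2380051/134217728)*p1*p1*p2 + (22460267/1073741824)*p1*p1*p1*p1 + (1061131/67108864)*p1*p4
    + (-1874663153/541165879296)*p1*p1*p3 + (-415547/8388608)*p1*p2*p2
    + (3248405/536870912)*p1*p1*p1*p2 + (-12606747/2147483648)*p1*p1*p1*p1*p1
    + (-1537559079181/10823317585920)*p2*p3 + (-2201549/67108864)*p2*p4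
    + (8443811149/2705829396480)*p1*p2*p3 + (3895409/268435456)*p2*p2*p2
    + (7605473/536870912)*p1*p1*p2*p2 + (242225/536870912)*p1*p1*p1*p1*p2
    + (570485/33554432)*p1*p1*p4 + (-163236263/15032385536)*p1*p1*p1*p3
    + (6738427/8589934592)*p1*p1*p1*p1*p1*p1 + (16040531111/90194313216)*p3*p3
    + (-40090965397/1546188226560)*p3*p4 + (-865965267983/10823317585920)*p1*p3*p3
    + (-676659/16777216)*p2*p2*p3 + (13341701839/257698037760)*p1*p1*p2*p3
    + (-1811003/1073741824)*p1*p1*p1*p1*p3 + (-824751/134217728)*p1*p2*p4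
    + (1429757/268435456)*p1*p2*p2*p2 + (-25421421/2147483648)*p1*p1*p1*p2*p2
    + (5697153/4294967296)*p1*p1*p1*p1*p1*p2 + (-1341741/536870912)*p1*p1*p1*p4
    + (-966087/8589934592)*p1*p1*p1*p1*p1*p1*p1 + (939933585763/8658654068736)*p4*p4
    + (-133354581569/1202590842880)*p1*p3*p4 + (-3362385/134217728)*p2*p2*p4
    + (522247/16777216)*p1*p1*p2*p4 + (-4393495/2147483648)*p1*p1*p1*p1*p4
    + (44809945729/1082331758592)*p1*p1*p3*p3 + (6542841/268435456)*p1*p2*p2*p3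
    + (-7208851163/270582939648)*p1*p1*p1*p2*p3 + (19956678349/10823317585920)*p1*p1*p1*p1*p1*p3
    + (8279909/1073741824)*p2*p2*p2*p2 + (-5516471/536870912)*p1*p1*p2*p2*p2
    + (6020329573/1030792151040)*p1*p1*p1*p1*p2*p2 + (-3220499/4294967296)*p1*p1*p1*p1*p1*p1*p2
    + (4236773/137438953472)*p1*p1*p1*p1*p1*p1*p1*p1)
    + (c62_uu p1 p2 * (1806*p2*p2 + (-672)*p1*p1*p2 + 1176*p1*p3 + 42*p1*p1*p1*p1 + (-2352)*p4)
    + c62_uv p1 p2 * (4200*p2*p3 + (-672)*p1*p1*p3 + (-672)*p1*p2*p2 + 1764*p1*p4 + 84*p1*p1*p1*p2 + (-4704)*p5)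
    + c62_uw p1 p2 * (1764*p3*p3 + (-588)*p1*p2*p3 + 588*p1*p5 + 42*p1*p1*p2*p2 + (-42)*p1*p1*p4 + 630*p2*p4
    + (-2352)*p6 + (-42)*p2*p2*p2)
    + c62_uz p1 p2 * (3612*p2*p4 + (-672)*p1*p1*p4 + (-672)*p1*p2*p3 + 1764*p1*p5 + 84*p1*p1*p1*p3 + 588*p3*p3
    + (-4704)*p6)
    + c62_vv p1 p2 * (5880*p2*p4 + 3696*p3*p3 + (-588)*p1*p1*p4 + (-1512)*p1*p2*p3 + 2352*p1*p5 + (-588)*p2*p2*p2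
    + 168*p1*p1*p2*p2 + (-9408)*p6)
    + c62_vw p1 p2 * (3612*p3*p4 + (-672)*p1*p2*p4 + 588*p1*p6 + (-672)*p2*p2*p3 + 1764*p2*p5 + 84*p1*p2*p2*p2
    + (-4704)*p7)
    + c62_vz p1 p2 * (4704*p2*p5 + 4872*p3*p4 + (-588)*p1*p1*p5 + (-756)*p1*p3*p3 + 2352*p1*p6 + (-756)*p1*p2*p4
    + (-588)*p2*p2*p3 + 168*p1*p1*p2*p3 + (-9408)*p7)
    + c62_ww p1 p2 * (1806*p4*p4 + (-672)*p2*p2*p4 + 1176*p2*p6 + 42*p2*p2*p2*p2 + (-2352)*p8)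
    + c62_wz p1 p2 * (4116*p3*p5 + (-588)*p1*p2*p5 + (-588)*p2*p3*p3 + 1176*p2*p6 + 84*p1*p2*p2*p3 + (-84)*p2*p2*p4
    + 588*p1*p7 + (-4704)*p8 + (-84)*p1*p3*p4 + 84*p4*p4)
    + c62_zz p1 p2 * (3528*p2*p6 + 3696*p4*p4 + (-588)*p1*p1*p6 + (-1512)*p1*p3*p4 + 2352*p1*p7 + (-588)*p2*p3*p3
    + 2352*p3*p5 + 168*p1*p1*p3*p3 + (-9408)*p8))
    + (c53_uu p1 * (16560*p2*p2*p2 + (-16200)*p1*p1*p2*p2 + 53280*p1*p2*p3 + 2880*p1*p1*p1*p1*p2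
    + (-9120)*p1*p1*p1*p3 + 28080*p1*p1*p4 + (-120)*p1*p1*p1*p1*p1*p1 + (-73440)*p2*p4
    + (-22080)*p3*p3 + (-60480)*p1*p5 + 80640*p6)
    + c53_uv p1 * (76320*p2*p2*p3 + (-46080)*p1*p1*p2*p3 + (-16200)*p1*p2*p2*p2 + 108000*p1*p2*p4 + 53280*p1*p3*p3
    + 2880*p1*p1*p1*p1*p3 + 5760*p1*p1*p1*p2*p2 + (-13680)*p1*p1*p1*p4 + 56160*p1*p1*p5
    + (-360)*p1*p1*p1*p1*p1*p2 + (-177120)*p2*p5 + (-139680)*p3*p4 + (-151200)*p1*p6 + 241920*p7)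
    + c53_vv p1 * (164160*p2*p2*p4 + 164160*p2*p3*p3 + (-73440)*p1*p1*p2*p4 + (-34560)*p1*p1*p3*p3
    + (-90720)*p1*p2*p2*p3 + 233280*p1*p2*p5 + 216000*p1*p3*p4 + (-11880)*p2*p2*p2*p2
    + 2160*p1*p1*p1*p1*p4 + 12960*p1*p1*p1*p2*p3 + (-17280)*p1*p1*p1*p5 + 103680*p1*p1*p6
    + 10800*p1*p1*p2*p2*p2 + (-1080)*p1*p1*p1*p1*p2*p2 + (-466560)*p2*p6 + (-397440)*p3*p5
    + (-177120)*p4*p4 + (-362880)*p1*p7 + 725760*p8))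
    + (c17_0 p1 p2 p3 * (p1 - p2) + c17_1 p1 p2 p3 * (p2 - p3) + c17_2 p1 p2 p3 * (p3 - p4)
    + c17_3 p1 p2 p3 * (p4 - p5) + c17_4 p1 p2 p3 * (p5 - p6) + c17_5 p1 p2 p3 * (p6 - p7)
    + c17_6 p1 p2 p3 * (p7 - p8)) := by
  simp only [c62_uu, c62_uv, c62_uw, c62_uz, c62_vv, c62_vw, c62_vz, c62_ww, c62_wz, c62_zz, c53_uu, c53_uv, c53_vv, c17_0, c17_1, c17_2, c17_3, c17_4, c17_5, c17_6]
  ring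

/-- Power sum polynomials. -/
noncomputable def P (k : ℕ) : MvPolynomial (Fin 8) ℝ := ∑ i, X i ^ k

lemma eval_P (x : Fin 8 → ℝ) (k : ℕ) : eval x (P k) = ps x k := by simp [P, ps]

/-! Degree bookkeeping. -/

/-- `p` has total degree at most `d`. -/
def Dg (d : ℕ) (p : MvPolynomial (Fin 8) ℝ) : Prop := p.totalDegree ≤ d

lemma Dg.add {a b : ℕ} {p q : MvPolynomial (Fin 8) ℝ} (h : Dg a p) (k : Dg b q) :
    Dg (max a b) (p + q) :=
  (totalDegree_add _ _).trans (max_le_max h k)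

lemma Dg.sub {a b : ℕ} {p q : MvPolynomial (Fin 8) ℝ} (h : Dg a p) (k : Dg b q) :
    Dg (max a b) (p - q) :=
  (totalDegree_sub _ _).trans (max_le_max h k)

lemma Dg.neg {a : ℕ} {p : MvPolynomial (Fin 8) ℝ} (h : Dg a p) : Dg a (-p) := by
  unfold Dg; rw [totalDegree_neg]; exact h

lemma Dg.mul {a b : ℕ} {p q : MvPolynomial (Fin 8) ℝ} (h : Dg a p) (k : Dg b q) :
    Dg (a + b) (p * q) :=
  (totalDegree_mul _ _).trans (Nat.add_le_add h k)

lemma Dg.pow {a : ℕ} {p : MvPolynomial (Fin 8) ℝ} (h : Dg a p) (n : ℕ) : Dg (n * a) (p ^ n) :=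
  (totalDegree_pow _ _).trans (Nat.mul_le_mul_left n h)

lemma Dg.one : Dg 0 1 := by simp [Dg]

lemma Dg.ofNat (n : ℕ) [n.AtLeastTwo] : Dg 0 (OfNat.ofNat n : MvPolynomial (Fin 8) ℝ) := by
  have : (OfNat.ofNat n : MvPolynomial (Fin 8) ℝ) = C (OfNat.ofNat n : ℝ) :=
    (map_ofNat C n).symm
  unfold Dg; rw [this, totalDegree_C]

lemma Dg.X (i : Fin 8) : Dg 1 (MvPolynomial.X i) := (totalDegree_X i).le

lemma Dg.P (k : ℕ) : Dg k (P k) := by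
  refine totalDegree_finsetSum_le fun i _ => ?_
  rw [totalDegree_X_pow]

lemma Dg.le {a d : ℕ} {p : MvPolynomial (Fin 8) ℝ} (h : Dg a p) (k : a ≤ d) : Dg d p :=
  le_trans h k

lemma deg_w11 (i j : Fin 8) : Dg 2 (w11 (P 1) (P 2) (X i) (X j)) := by
  unfold w11
  apply Dg.le
  case h =>
    repeat' (with_reducible first | exact Dg.P _ | exact Dg.X _ | exact Dg.ofNat _ | exact Dg.one | apply Dg.add | apply Dg.sub | apply Dg.neg | apply Dg.mul | apply Dg.pow)
  case k => decide

lemma deg_w21 (i j : Fin 8) : Dg 3 (w21 (P 1) (P 2) (P 3) (X i) (X j)) := by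
  unfold w21
  apply Dg.le
  case h =>
    repeat' (with_reducible first | exact Dg.P _ | exact Dg.X _ | exact Dg.ofNat _ | exact Dg.one | apply Dg.add | apply Dg.sub | apply Dg.neg | apply Dg.mul | apply Dg.pow)
  case k => decide

lemma deg_w22 (i j : Fin 8) : Dg 4 (w22 (P 2) (P 4) (X i) (X j)) := by
  unfold w22
  apply Dg.le
  case h =>
    repeat' (with_reducible first | exact Dg.P _ | exact Dg.X _ | exact Dg.ofNat _ | exact Dg.one | apply Dg.add | apply Dg.sub | apply Dg.neg | apply Dg.mul | apply Dg.pow)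
  case k => decide

lemma deg_w31 (i j : Fin 8) : Dg 4 (w31 (P 1) (P 3) (P 4) (X i) (X j)) := by
  unfold w31
  apply Dg.le
  case h =>
    repeat' (with_reducible first | exact Dg.P _ | exact Dg.X _ | exact Dg.ofNat _ | exact Dg.one | apply Dg.add | apply Dg.sub | apply Dg.neg | apply Dg.mul | apply Dg.pow)
  case k => decide

lemma deg_w111 (i j k : Fin 8) : Dg 3 (w111 (P 1) (P 2) (P 3) (X i) (X j) (X k)) := by
  unfold w111
  apply Dg.le
  case h =>
    repeat' (with_reducible first | exact Dg.P _ | exact Dg.X _ | exact Dg.ofNat _ | exact Dg.one | apply Dg.add | apply Dg.sub | apply Dg.neg | apply Dg.mul | apply Dg.pow)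
  case k => decide

lemma deg_w211 (i j k : Fin 8) :
    Dg 4 (w211 (P 1) (P 2) (P 3) (P 4) (X i) (X j) (X k)) := by
  unfold w211
  apply Dg.le
  case h =>
    repeat' (with_reducible first | exact Dg.P _ | exact Dg.X _ | exact Dg.ofNat _ | exact Dg.one | apply Dg.add | apply Dg.sub | apply Dg.neg | apply Dg.mul | apply Dg.pow)
  case k => decide

lemma deg_v8 : ∀ q ∈ v8 (P 1) (P 2) (P 3) (P 4), q.totalDegree ≤ 4 := by
  simp only [v8, List.forall_mem_cons]
  refine ⟨?_, ?_, ?_, ?_, ?_, ?_, ?_, ?_, ?_, ?_, ?_, ?_, by simp⟩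
  all_goals
    change Dg 4 _
    apply Dg.le
    case h =>
      repeat' (with_reducible first | exact Dg.P _ | exact Dg.one | apply Dg.mul | apply Dg.pow)
    case k => decide

lemma deg_v17 (i : Fin 8) : ∀ q ∈ v17 (P 1) (P 2) (P 3) (X i), q.totalDegree ≤ 3 := by
  simp only [v17, List.forall_mem_cons]
  refine ⟨?_, ?_, ?_, ?_, ?_, ?_, ?_, ?_, ?_, ?_, ?_, ?_, ?_, ?_, by simp⟩
  all_goals
    change Dg 3 _
    apply Dg.le
    case h =>
      repeat' (with_reducible first | exact Dg.P _ | exact Dg.X _ | exact Dg.one | apply Dg.mul | apply Dg.pow)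
    case k => decide

lemma deg_v62 (u v w z : MvPolynomial (Fin 8) ℝ) (hu : Dg 2 u) (hv : Dg 3 v) (hw : Dg 4 w)
    (hz : Dg 4 z) : ∀ q ∈ v62 (P 1) (P 2) u v w z, q.totalDegree ≤ 4 := by
  simp only [v62, List.forall_mem_cons]
  refine ⟨?_, ?_, ?_, ?_, ?_, ?_, ?_, ?_, by simp⟩
  all_goals
    change Dg 4 _
    apply Dg.le
    case h =>
      repeat' (with_reducible first | exact Dg.P _ | exact hu | exact hv | exact hw | exact hz | apply Dg.mul | apply Dg.pow)
    case k => decide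

lemma deg_v53 (u v : MvPolynomial (Fin 8) ℝ) (hu : Dg 3 u) (hv : Dg 4 v) :
    ∀ q ∈ v53 (P 1) u v, q.totalDegree ≤ 4 := by
  simp only [v53, List.forall_mem_cons]
  refine ⟨?_, ?_, ?_, by simp⟩
  all_goals
    change Dg 4 _
    apply Dg.le
    case h =>
      repeat' (with_reducible first | exact Dg.P _ | exact hu | exact hv | apply Dg.mul)
    case k => decide

/-- Pair squares. -/
noncomputable def T62 (i j : Fin 8) : MvPolynomial (Fin 8) ℝ :=
  ldlP cs62 (v62 (P 1) (P 2) (w11 (P 1) (P 2) (X i) (X j)) (w21 (P 1) (P 2) (P 3) (X i) (X j))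
    (w22 (P 2) (P 4) (X i) (X j)) (w31 (P 1) (P 3) (P 4) (X i) (X j)))

/-- Triple squares. -/
noncomputable def T53 (i j k : Fin 8) : MvPolynomial (Fin 8) ℝ :=
  ldlP cs53 (v53 (P 1) (w111 (P 1) (P 2) (P 3) (X i) (X j) (X k))
    (w211 (P 1) (P 2) (P 3) (P 4) (X i) (X j) (X k)))

/-- The multiplier `σ₀`. -/
noncomputable def sig0 : MvPolynomial (Fin 8) ℝ :=
  ldlP cs8 (v8 (P 1) (P 2) (P 3) (P 4))
    + (∑ i, ∑ j, if i = j then 0 else T62 i j)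
    + ∑ i, ∑ j, ∑ k, if i = j ∨ i = k ∨ j = k then 0 else T53 i j k

/-- The multipliers `σ_i`. -/
noncomputable def sig (i : Fin 8) : MvPolynomial (Fin 8) ℝ :=
  ldlP cs17 (v17 (P 1) (P 2) (P 3) (X i))

lemma sig0_sos : SOSd 4 sig0 := by
  refine ((ldlP_sos _ _ cs8_nonneg deg_v8).add ?_).add ?_
  · refine SOSd.sum _ _ fun i => SOSd.sum _ _ fun j => ?_
    split_ifs
    · exact SOSd.zero 4
    · exact ldlP_sos _ _ cs62_nonneg
        (deg_v62 _ _ _ _ (deg_w11 i j) (deg_w21 i j) (deg_w22 i j) (deg_w31 i j))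
  · refine SOSd.sum _ _ fun i => SOSd.sum _ _ fun j => SOSd.sum _ _ fun k => ?_
    split_ifs
    · exact SOSd.zero 4
    · exact ldlP_sos _ _ cs53_nonneg (deg_v53 _ _ (deg_w111 i j k) (deg_w211 i j k))

lemma sig_sos (i : Fin 8) : SOSd 3 (sig i) := ldlP_sos _ _ cs17_nonneg (deg_v17 i)

/-! Evaluation of the four families. -/

lemma S2_add (x : Fin 8 → ℝ) (F G : ℝ → ℝ → ℝ) :
    S2 x (fun a b => F a b + G a b) = S2 x F + S2 x G := by
  simp only [S2_eq, Finset.sum_add_distrib]; ring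

lemma S2_mul (x : Fin 8 → ℝ) (r : ℝ) (F : ℝ → ℝ → ℝ) :
    S2 x (fun a b => r * F a b) = r * S2 x F := by
  simp only [S2_eq, ← Finset.mul_sum]; ring

lemma S3_add (x : Fin 8 → ℝ) (F G : ℝ → ℝ → ℝ → ℝ) :
    S3 x (fun a b c => F a b c + G a b c) = S3 x F + S3 x G := by
  simp only [S3, ← Finset.sum_add_distrib]
  refine Finset.sum_congr rfl fun i _ => Finset.sum_congr rfl fun j _ =>
    Finset.sum_congr rfl fun k _ => ?_
  split_ifs <;> simp

lemma S3_mul (x : Fin 8 → ℝ) (r : ℝ) (F : ℝ → ℝ → ℝ → ℝ) :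
    S3 x (fun a b c => r * F a b c) = r * S3 x F := by
  simp only [S3, Finset.mul_sum]
  refine Finset.sum_congr rfl fun i _ => Finset.sum_congr rfl fun j _ =>
    Finset.sum_congr rfl fun k _ => ?_
  split_ifs <;> simp

lemma eval_T62 (x : Fin 8 → ℝ) (i j : Fin 8) :
    eval x (T62 i j) = ldlR cs62 (v62 (ps x 1) (ps x 2) (w11 (ps x 1) (ps x 2) (x i) (x j))
      (w21 (ps x 1) (ps x 2) (ps x 3) (x i) (x j)) (w22 (ps x 2) (ps x 4) (x i) (x j))
      (w31 (ps x 1) (ps x 3) (ps x 4) (x i) (x j))) := by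
  rw [T62, eval_ldlP]
  simp only [v62, w11, w21, w22, w31, List.map_cons, List.map_nil, map_add, map_sub, map_neg,
    map_mul, map_pow, map_ofNat, map_one, eval_P, eval_X]

lemma eval_T53 (x : Fin 8 → ℝ) (i j k : Fin 8) :
    eval x (T53 i j k) = ldlR cs53 (v53 (ps x 1)
      (w111 (ps x 1) (ps x 2) (ps x 3) (x i) (x j) (x k))
      (w211 (ps x 1) (ps x 2) (ps x 3) (ps x 4) (x i) (x j) (x k))) := by
  rw [T53, eval_ldlP]
  simp only [v53, w111, w211, List.map_cons, List.map_nil, map_add, map_sub, map_neg,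
    map_mul, map_pow, map_ofNat, map_one, eval_P, eval_X]

lemma eval_sig (x : Fin 8 → ℝ) (i : Fin 8) :
    eval x (sig i) = ldlR cs17 (v17 (ps x 1) (ps x 2) (ps x 3) (x i)) := by
  rw [sig, eval_ldlP]
  simp only [v17, List.map_cons, List.map_nil, map_mul, map_pow, map_one, eval_P, eval_X]

lemma eval_sig0 (x : Fin 8 → ℝ) :
    eval x sig0 = ldlR cs8 (v8 (ps x 1) (ps x 2) (ps x 3) (ps x 4))
      + S2 x (fun a b => ldlR cs62 (v62 (ps x 1) (ps x 2) (w11 (ps x 1) (ps x 2) a b)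
          (w21 (ps x 1) (ps x 2) (ps x 3) a b) (w22 (ps x 2) (ps x 4) a b)
          (w31 (ps x 1) (ps x 3) (ps x 4) a b)))
      + S3 x (fun a b c => ldlR cs53 (v53 (ps x 1) (w111 (ps x 1) (ps x 2) (ps x 3) a b c)
          (w211 (ps x 1) (ps x 2) (ps x 3) (ps x 4) a b c))) := by
  simp only [sig0, map_add, map_sum, S2, S3, apply_ite (eval x), map_zero, eval_T62, eval_T53]
  congr 2
  rw [eval_ldlP]
  simp only [v8, List.map_cons, List.map_nil, map_mul, map_pow, map_one, eval_P]

lemma sum17 (x : Fin 8 → ℝ) (c0 c1 c2 c3 c4 c5 c6 : ℝ) :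
    ∑ i, (c0 * x i ^ 0 + c1 * x i ^ 1 + c2 * x i ^ 2 + c3 * x i ^ 3 + c4 * x i ^ 4
      + c5 * x i ^ 5 + c6 * x i ^ 6) * (x i - x i ^ 2) =
    c0 * (ps x 1 - ps x 2) + c1 * (ps x 2 - ps x 3) + c2 * (ps x 3 - ps x 4)
      + c3 * (ps x 4 - ps x 5) + c4 * (ps x 5 - ps x 6) + c5 * (ps x 6 - ps x 7)
      + c6 * (ps x 7 - ps x 8) := by
  simp only [ps, ← Finset.sum_sub_distrib, Finset.mul_sum, ← Finset.sum_add_distrib]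
  refine Finset.sum_congr rfl fun i _ => ?_
  ring

lemma newton (x : Fin 8 → ℝ) (p1 p2 p3 p4 p5 p6 p7 p8 : ℝ)
    (e1 : ps x 1 = p1) (e2 : ps x 2 = p2) (e3 : ps x 3 = p3) (e4 : ps x 4 = p4)
    (e5 : ps x 5 = p5) (e6 : ps x 6 = p6) (e7 : ps x 7 = p7) (e8 : ps x 8 = p8) :
    ∏ i, x i = (1/40320)*p1*p1*p1*p1*p1*p1*p1*p1 + (-1/1440)*p1*p1*p1*p1*p1*p1*p2 + (1/360)*p1*p1*p1*p1*p1*p3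
    + (1/192)*p1*p1*p1*p1*p2*p2 + (-1/96)*p1*p1*p1*p1*p4 + (-1/36)*p1*p1*p1*p2*p3
    + (1/30)*p1*p1*p1*p5 + (-1/96)*p1*p1*p2*p2*p2 + (1/16)*p1*p1*p2*p4 + (1/36)*p1*p1*p3*p3
    + (-1/12)*p1*p1*p6 + (1/24)*p1*p2*p2*p3 + (-1/10)*p1*p2*p5 + (-1/12)*p1*p3*p4 + (1/7)*p1*p7
    + (1/384)*p2*p2*p2*p2 + (-1/32)*p2*p2*p4 + (-1/36)*p2*p3*p3 + (1/12)*p2*p6 + (1/15)*p3*p5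
    + (1/32)*p4*p4 + (-1/8)*p8 := by
  have hp : ∀ k, eval x (psum (Fin 8) ℝ k) = ps x k := fun k => eval_P x k
  have hN : ∀ k : ℕ, (k : ℝ) * eval x (esymm (Fin 8) ℝ k) = (-1) ^ (k + 1) *
      ∑ a ∈ Finset.HasAntidiagonal.antidiagonal k with a.1 < k,
        (-1) ^ a.1 * eval x (esymm (Fin 8) ℝ a.1) * ps x a.2 := by
    intro k
    have := congrArg (eval x) (mul_esymm_eq_sum (Fin 8) ℝ k)
    simpa [hp] using this
  have h8 : eval x (esymm (Fin 8) ℝ 8) = ∏ i, x i := by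
    have : (Finset.powersetCard 8 (Finset.univ : Finset (Fin 8))) = {Finset.univ} := by
      simpa using Finset.powersetCard_self (Finset.univ : Finset (Fin 8))
    rw [esymm, this]
    simp
  rw [← h8]
  have h0 : eval x (esymm (Fin 8) ℝ 0) = 1 := by simp
  have n1 := hN 1
  have n2 := hN 2
  have n3 := hN 3
  have n4 := hN 4
  have n5 := hN 5
  have n6 := hN 6
  have n7 := hN 7
  have n8 := hN 8
  simp only [Finset.sum_filter, Finset.Nat.sum_antidiagonal_eq_sum_range_succ_mk,
    Finset.sum_range_succ, Finset.sum_range_zero] at n1 n2 n3 n4 n5 n6 n7 n8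
  norm_num [e1, e2, e3, e4, e5, e6, e7, e8] at n1 n2 n3 n4 n5 n6 n7 n8
  generalize eval x (esymm (Fin 8) ℝ 1) = s1 at *
  generalize eval x (esymm (Fin 8) ℝ 2) = s2 at *
  generalize eval x (esymm (Fin 8) ℝ 3) = s3 at *
  generalize eval x (esymm (Fin 8) ℝ 4) = s4 at *
  generalize eval x (esymm (Fin 8) ℝ 5) = s5 at *
  generalize eval x (esymm (Fin 8) ℝ 6) = s6 at *
  generalize eval x (esymm (Fin 8) ℝ 7) = s7 at *
  generalize eval x (esymm (Fin 8) ℝ 8) = s8 at *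
  rw [n1] at n2 n3 n4 n5 n6 n7 n8
  have q2 := eq_div_of_mul_eq (by norm_num) ((mul_comm _ _).trans n2)
  subst q2
  have q3 := eq_div_of_mul_eq (by norm_num) ((mul_comm _ _).trans n3)
  subst q3
  have q4 := eq_div_of_mul_eq (by norm_num) ((mul_comm _ _).trans n4)
  subst q4
  have q5 := eq_div_of_mul_eq (by norm_num) ((mul_comm _ _).trans n5)
  subst q5
  have q6 := eq_div_of_mul_eq (by norm_num) ((mul_comm _ _).trans n6)
  subst q6
  have q7 := eq_div_of_mul_eq (by norm_num) ((mul_comm _ _).trans n7)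
  subst q7
  linear_combination (1 / 8) * n8

lemma real_identity (x : Fin 8 → ℝ) :
    ∏ i, x i + 11 / 1000 = eval x sig0 + ∑ i, eval x (sig i) * (x i - x i ^ 2) := by
  rw [eval_sig0]
  simp only [eval_sig, block8, block62, block53, block17, S2_add, S2_mul, S3_add, S3_mul, sum17]
  obtain ⟨p1, e1⟩ : ∃ p, ps x 1 = p := ⟨_, rfl⟩
  obtain ⟨p2, e2⟩ : ∃ p, ps x 2 = p := ⟨_, rfl⟩
  obtain ⟨p3, e3⟩ : ∃ p, ps x 3 = p := ⟨_, rfl⟩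
  obtain ⟨p4, e4⟩ : ∃ p, ps x 4 = p := ⟨_, rfl⟩
  obtain ⟨p5, e5⟩ : ∃ p, ps x 5 = p := ⟨_, rfl⟩
  obtain ⟨p6, e6⟩ : ∃ p, ps x 6 = p := ⟨_, rfl⟩
  obtain ⟨p7, e7⟩ : ∃ p, ps x 7 = p := ⟨_, rfl⟩
  obtain ⟨p8, e8⟩ : ∃ p, ps x 8 = p := ⟨_, rfl⟩
  simp only [e1, e2, e3, e4, e5, e6, e7, e8]
  rw [k62_uu x _ _ _ _ _ _ _ _ e1 e2 e3 e4 e5 e6 e7 e8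
    , k62_uv x _ _ _ _ _ _ _ _ e1 e2 e3 e4 e5 e6 e7 e8
    , k62_uw x _ _ _ _ _ _ _ _ e1 e2 e3 e4 e5 e6 e7 e8
    , k62_uz x _ _ _ _ _ _ _ _ e1 e2 e3 e4 e5 e6 e7 e8
    , k62_vv x _ _ _ _ _ _ _ _ e1 e2 e3 e4 e5 e6 e7 e8
    , k62_vw x _ _ _ _ _ _ _ _ e1 e2 e3 e4 e5 e6 e7 e8
    , k62_vz x _ _ _ _ _ _ _ _ e1 e2 e3 e4 e5 e6 e7 e8
    , k62_ww x _ _ _ _ _ _ _ _ e1 e2 e3 e4 e5 e6 e7 e8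
    , k62_wz x _ _ _ _ _ _ _ _ e1 e2 e3 e4 e5 e6 e7 e8
    , k62_zz x _ _ _ _ _ _ _ _ e1 e2 e3 e4 e5 e6 e7 e8
    , k53_uu x _ _ _ _ _ _ _ _ e1 e2 e3 e4 e5 e6 e7 e8
    , k53_uv x _ _ _ _ _ _ _ _ e1 e2 e3 e4 e5 e6 e7 e8
    , k53_vv x _ _ _ _ _ _ _ _ e1 e2 e3 e4 e5 e6 e7 e8]
  rw [newton x _ _ _ _ _ _ _ _ e1 e2 e3 e4 e5 e6 e7 e8]
  exact final_ring p1 p2 p3 p4 p5 p6 p7 p8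

theorem membership : InQuadModule 8 4 ((∏ i : Fin 8, X i) + C (11 / 1000 : ℝ)) := by
  refine ⟨sig0, sig, sig0_sos.1, fun i => (sig_sos i).1, sig0_sos.2, fun i => (sig_sos i).2, ?_⟩
  refine MvPolynomial.funext fun x => ?_
  have := real_identity x
  simpa using this

lemma nonneg_of_mem {c : ℝ} (h : InQuadModule 8 4 ((∏ i : Fin 8, X i) + C c)) : 0 ≤ c := by
  obtain ⟨s0, s, ⟨k, q, hq⟩, -, -, -, h⟩ := h
  have := congrArg (eval (fun _ : Fin 8 => (0:ℝ))) h
  simp only [map_add, map_prod, map_sum, map_mul, map_sub, map_pow, eval_X, eval_C, hq] at this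
  norm_num at this
  rw [this]
  exact Finset.sum_nonneg fun i _ => sq_nonneg _

end HypercubeCert

theorem deKlerk_Laurent_counterexample_n8 :
    InQuadModule 8 4 ((∏ i : Fin 8, X i) + C (11 / 1000 : ℝ)) ∧
    sInf {c : ℝ | InQuadModule 8 4 ((∏ i : Fin 8, X i) + C c)} ≤ 11 / 1000 ∧
    (11 / 1000 : ℝ) < 1 / 80 := by
  refine ⟨HypercubeCert.membership, ?_, by norm_num⟩
  exact csInf_le ⟨0, fun c hc => HypercubeCert.nonneg_of_mem hc⟩ HypercubeCert.membership
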